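/- arXiv:math/0210131 — 4 statements merged into one kernel-verified Lean document; each statement's English description precedes it below -/
import Mathlib

section
/- Let (R,m) be an F-finite reduced excellent local ring of prime characteristic p > 0, and let a ⊆ R be an ideal of positive height possessing a reduction generated by l elements. Let b be an ideal of R with b ∩ R° ≠ ∅ and let t ≥ 0 be a rational number. If condition (*) is satisfied for a^{l-1}·b^t and for a^l·b^t, then τ(a^l·b^t) = τ(a^{l-1}·b^t)·a. -/
open scoped TensorProduct

universe u

variable (R : Type u) [CommRing R]

/-- `R°`: the set of elements of `R` not contained in any minimal prime ideal. -/
def Rcirc : Set R := {c : R | ∀ P ∈ minimalPrimes R, c ∉ P}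

/-- The Frobenius power `I^{[q]}`: the ideal generated by the `q`-th powers of elements of `I`. -/
def frobPow (I : Ideal R) (q : ℕ) : Ideal R := Ideal.span ((fun x : R => x ^ q) '' (I : Set R))

/-- The `a^t`-tight closure of an ideal `J`. -/
def tightClosure (p : ℕ) (a : Ideal R) (t : ℚ) (J : Ideal R) : Set R :=
  {z : R | ∃ c ∈ Rcirc R, ∃ e₀ : ℕ, ∀ e : ℕ, e₀ ≤ e →
    ∀ x ∈ a ^ ⌈t * (p : ℚ) ^ e⌉₊, c * z ^ p ^ e * x ∈ frobPow R J (p ^ e)}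

/-- The generalized test ideal `τ(a^t) = ⋂_J (J : J^{*aᵗ})`. -/
def testIdeal (p : ℕ) (a : Ideal R) (t : ℚ) : Ideal R :=
  ⨅ J : Ideal R, Submodule.colon J (Ideal.span (tightClosure R p a t J))

/-- `R` is F-finite: finitely generated over itself via the Frobenius endomorphism. -/
def FrobAlg (p e : ℕ) : Type u := R

instance : CommRing (FrobAlg R p e) := inferInstanceAs (CommRing R)

/-- The identity of `R`, viewed as a ring map `R →+* ᵉR`. -/
def FrobAlg.of (p e : ℕ) : R →+* FrobAlg R p e := RingHom.id R

noncomputable instance [ExpChar R p] : Algebra R (FrobAlg R p e) :=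
  ((FrobAlg.of R p e).comp (iterateFrobenius R p e)).toAlgebra

/-- F-finiteness of `R`. -/
def IsFFinite (p : ℕ) [ExpChar R p] : Prop := Module.Finite R (FrobAlg R p 1)

/-- `0^{*aᵗ}_M`, the `aᵗ`-tight closure of zero in a module `M`. -/
def moduleTC (p : ℕ) [ExpChar R p] (a : Ideal R) (t : ℚ)
    (M : Type u) [AddCommGroup M] [Module R M] : Set M :=
  {z : M | ∃ c ∈ Rcirc R, ∃ e₀ : ℕ, ∀ e : ℕ, e₀ ≤ e →
    ∀ x ∈ a ^ ⌈t * (p : ℚ) ^ e⌉₊,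
      (FrobAlg.of R p e (c * x)) ⊗ₜ[R] z = (0 : TensorProduct R (FrobAlg R p e) M)}

/-- `τ̃(aᵗ) = Ann_R (0^{*aᵗ}_E)`. -/
def tildeTau (p : ℕ) [ExpChar R p] (a : Ideal R) (t : ℚ)
    (E : Type u) [AddCommGroup E] [Module R E] : Ideal R :=
  (Submodule.span R (moduleTC R p a t E)).annihilator

/-- `E` is an injective hull of the `R`-module `M`. -/
def IsInjectiveHull (M : Type u) [AddCommGroup M] [Module R M]
    (E : Type u) [AddCommGroup E] [Module R E] : Prop :=
  Module.Injective R E ∧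
    ∃ ι : M →ₗ[R] E, Function.Injective ι ∧
      ∀ N : Submodule R E, N ≠ ⊥ → N ⊓ LinearMap.range ι ≠ ⊥

/-- `d` is an `aᵗ`-test element. -/
def IsTestElement (p : ℕ) [ExpChar R p] (a : Ideal R) (t : ℚ) (d : R) : Prop :=
  d ∈ Rcirc R ∧
    ∀ (M : Type u) [AddCommGroup M] [Module R M], Module.Finite R M →
      ∀ z : M, z ∈ moduleTC R p a t M ↔
        ∀ e : ℕ, ∀ x ∈ a ^ ⌈t * (p : ℚ) ^ e⌉₊,
          (FrobAlg.of R p e (d * x)) ⊗ₜ[R] z = (0 : TensorProduct R (FrobAlg R p e) M)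



/-- The `aˢ·bᵗ`-tight closure of an ideal `J` (bi-exponent version). -/
def tightClosure2 (p : ℕ) (a b : Ideal R) (s : ℕ) (t : ℚ) (J : Ideal R) : Set R :=
  {z : R | ∃ c ∈ Rcirc R, ∃ e₀ : ℕ, ∀ e : ℕ, e₀ ≤ e →
    ∀ x ∈ a ^ (s * p ^ e) * b ^ ⌈t * (p : ℚ) ^ e⌉₊,
      c * z ^ p ^ e * x ∈ frobPow R J (p ^ e)}

/-- The generalized test ideal `τ(aˢ·bᵗ)`. -/
def testIdeal2 (p : ℕ) (a b : Ideal R) (s : ℕ) (t : ℚ) : Ideal R :=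
  ⨅ J : Ideal R, Submodule.colon J (Ideal.span (tightClosure2 R p a b s t J))
/-- `0^{*aˢbᵗ}_M`, the `aˢ·bᵗ`-tight closure of zero in a module `M`. -/
def moduleTC2 (p : ℕ) [ExpChar R p] (a b : Ideal R) (s : ℕ) (t : ℚ)
    (M : Type u) [AddCommGroup M] [Module R M] : Set M :=
  {z : M | ∃ c ∈ Rcirc R, ∃ e₀ : ℕ, ∀ e : ℕ, e₀ ≤ e →
    ∀ x ∈ a ^ (s * p ^ e) * b ^ ⌈t * (p : ℚ) ^ e⌉₊,
      (FrobAlg.of R p e (c * x)) ⊗ₜ[R] z = (0 : TensorProduct R (FrobAlg R p e) M)}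

/-- `τ̃(aˢ·bᵗ) = Ann_R (0^{*aˢbᵗ}_E)`. -/
def tildeTau2 (p : ℕ) [ExpChar R p] (a b : Ideal R) (s : ℕ) (t : ℚ)
    (E : Type u) [AddCommGroup E] [Module R E] : Ideal R :=
  (Submodule.span R (moduleTC2 R p a b s t E)).annihilator


/-- For `M` finite over Noetherian `R` and `E` injective, `M ⊗ E → Hom (Hom (M, R), E)` is
injective on pure tensors. -/
theorem tmul_eq_zero_of_dual {R : Type u} [CommRing R] [IsNoetherianRing R]
    {M : Type u} [AddCommGroup M] [Module R M] [Module.Finite R M]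
    {E : Type u} [AddCommGroup E] [Module R E] (hE : Module.Injective R E)
    (y : M) (z : E) (h : ∀ φ : M →ₗ[R] R, φ y • z = 0) : y ⊗ₜ[R] z = 0 := by
  obtain ⟨n, π, hπ⟩ := Module.Finite.exists_fin' R M
  obtain ⟨m, A₀, hA₀⟩ := Module.Finite.exists_fin' R (LinearMap.ker π)
  let a : Fin m → Fin n → R := fun j => (A₀ (Pi.single j 1)).1
  have ha : ∀ j, π (a j) = 0 := fun j => (A₀ (Pi.single j 1)).2
  obtain ⟨v, hv⟩ := hπ y
  have hker : ∀ w ∈ LinearMap.ker π, ∃ r : Fin m → R, w = ∑ j, r j • a j := by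
    intro w hw
    obtain ⟨r, hr⟩ := hA₀ ⟨w, hw⟩
    refine ⟨r, ?_⟩
    have h1 : r = ∑ j, r j • (Pi.single j (1:R) : Fin m → R) := by
      ext i; simp [Finset.sum_apply, Pi.single_apply]
    rw [h1, map_sum] at hr
    have := congrArg Subtype.val hr
    simp only [map_smul] at this
    rw [← this]
    simp [a]
  let dot : (Fin n → R) → (Fin n → R) →ₗ[R] R := fun w => ∑ i, w i • LinearMap.proj i
  have hdot : ∀ w u, dot w u = ∑ i, w i * u i := by intro w u; simp [dot]
  let At : (Fin n → R) →ₗ[R] (Fin m → R) := LinearMap.pi fun j => dot (a j)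
  let L : (Fin n → R) →ₗ[R] E := (LinearMap.toSpanSingleton R E z).comp (dot v)
  have hL : LinearMap.ker At ≤ LinearMap.ker L := by
    intro w hw
    have hw' : ∀ j, dot (a j) w = 0 := fun j => congrFun (LinearMap.mem_ker.1 hw) j
    have hle : LinearMap.ker π ≤ LinearMap.ker (dot w) := by
      intro u hu
      obtain ⟨r, rfl⟩ := hker u hu
      rw [LinearMap.mem_ker, map_sum]
      refine Finset.sum_eq_zero fun j _ => ?_
      rw [map_smul, hdot]
      have := hw' j
      rw [hdot] at this
      simp_rw [mul_comm (w _)]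
      rw [this, smul_zero]
    let φ : M →ₗ[R] R := ((LinearMap.ker π).liftQ (dot w) hle).comp
      (π.quotKerEquivOfSurjective hπ).symm.toLinearMap
    have hφ : φ y = dot w v := by
      have : (π.quotKerEquivOfSurjective hπ).symm y = Submodule.Quotient.mk v := by
        rw [LinearEquiv.symm_apply_eq, ← hv]; rfl
      simp [φ, this]
    have h2 := h φ
    rw [hφ] at h2
    rw [LinearMap.mem_ker]
    simp only [L, LinearMap.comp_apply, LinearMap.toSpanSingleton_apply]
    rw [← h2, hdot, hdot]
    simp_rw [mul_comm (w _)]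
  obtain ⟨g, hg⟩ := hE.out ((LinearMap.ker At).liftQ At le_rfl)
    (LinearMap.ker_eq_bot.1 (Submodule.ker_liftQ_eq_bot _ _ _ le_rfl))
    ((LinearMap.ker At).liftQ L hL)
  have hg' : ∀ w, g (At w) = L w := fun w => by
    simpa using hg (Submodule.Quotient.mk w)
  let ε : Fin m → E := fun j => g (Pi.single j 1)
  have key : ∀ i, v i • z = ∑ j, a j i • ε j := by
    intro i
    have h1 := hg' (Pi.single i 1)
    have h2 : At (Pi.single i 1) = ∑ j, a j i • (Pi.single j (1:R) : Fin m → R) := by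
      ext j
      simp [At, hdot, Finset.sum_apply, Pi.single_apply]
    rw [h2, map_sum] at h1
    simp only [map_smul] at h1
    rw [show L (Pi.single i 1) = v i • z by
      simp [L, hdot, Pi.single_apply]] at h1
    exact h1.symm
  have hpi : ∀ u : Fin n → R, π u = ∑ i, u i • π (Pi.single i 1) := by
    intro u
    conv_lhs => rw [show u = ∑ i, u i • (Pi.single i (1:R) : Fin n → R) by
      ext k; simp [Finset.sum_apply, Pi.single_apply]]
    simp [map_sum]
  rw [← hv, hpi, TensorProduct.sum_tmul]
  simp_rw [TensorProduct.smul_tmul, key, TensorProduct.tmul_sum, ← TensorProduct.smul_tmul]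
  rw [Finset.sum_comm]
  refine Finset.sum_eq_zero fun j _ => ?_
  rw [← TensorProduct.sum_tmul, ← hpi, ha, TensorProduct.zero_tmul]

/-- Double annihilator property. -/
theorem mem_of_annihilates {R : Type u} [CommRing R] [IsLocalRing R]
    {E : Type u} [AddCommGroup E] [Module R E]
    (hE : IsInjectiveHull R (R ⧸ IsLocalRing.maximalIdeal R) E) (J : Ideal R) (r : R)
    (h : ∀ z : E, (∀ j ∈ J, j • z = 0) → r • z = 0) : r ∈ J := by
  by_contra hr
  obtain ⟨hinj, ι, hι, -⟩ := hE
  let x : R ⧸ J := Ideal.Quotient.mk J r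
  have hx : x ≠ 0 := fun h0 => hr (Ideal.Quotient.eq_zero_iff_mem.1 h0)
  let T := Ideal.torsionOf R (R ⧸ J) x
  have hT : T ≤ IsLocalRing.maximalIdeal R := by
    apply IsLocalRing.le_maximalIdeal
    intro hT
    have : (1:R) ∈ T := hT ▸ Submodule.mem_top
    rw [Ideal.mem_torsionOf_iff, one_smul] at this
    exact hx this
  let f : (R ⧸ T) →ₗ[R] E := ι.comp (Submodule.factor hT)
  let Q := Ideal.quotTorsionOfEquivSpanSingleton R (R ⧸ J) x
  obtain ⟨g, hg⟩ := hinj.out (R ∙ x).subtype (Submodule.injective_subtype _)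
    (f.comp Q.symm.toLinearMap)
  have h1 := hg (Q (Submodule.Quotient.mk 1))
  have h2 : ((R ∙ x).subtype (Q (Submodule.Quotient.mk 1))) = x := by
    have : Q (Submodule.Quotient.mk 1) = (1 : R) • ⟨x, Submodule.mem_span_singleton_self x⟩ :=
      Ideal.quotTorsionOfEquivSpanSingleton_apply_mk x 1
    rw [this]; simp
  rw [h2] at h1
  have h3 : g x = ι (Submodule.Quotient.mk 1) := by
    rw [h1]; simp [f]
  have hx1 : x = r • (Ideal.Quotient.mk J 1) := by
    simp [x, Algebra.smul_def]
  have h4 := h (g (Ideal.Quotient.mk J 1)) (by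
    intro j hj
    rw [← map_smul]
    have : j • (Ideal.Quotient.mk J 1) = 0 := by
      simpa [Algebra.smul_def] using Ideal.Quotient.eq_zero_iff_mem.2 hj
    rw [this, map_zero])
  rw [← map_smul, ← hx1, h3] at h4
  have h5 : (Submodule.Quotient.mk 1 : R ⧸ IsLocalRing.maximalIdeal R) = 0 :=
    hι (by rw [h4, map_zero])
  rw [Submodule.Quotient.mk_eq_zero] at h5
  exact (IsLocalRing.maximalIdeal R).ne_top_iff_one.1 (IsLocalRing.maximalIdeal.isMaximal R).ne_top h5

/-- Prime avoidance for the minimal primes. -/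
theorem exists_mem_Rcirc {R : Type u} [CommRing R] [IsNoetherianRing R] (I : Ideal R)
    (hI : ∀ P ∈ minimalPrimes R, ¬ I ≤ P) : ∃ c ∈ I, c ∈ Rcirc R := by
  by_contra hcon
  push Not at hcon
  have hfin := minimalPrimes.finite_of_isNoetherianRing R
  have : (I : Set R) ⊆ ⋃ P ∈ (hfin.toFinset : Set (Ideal R)), (P : Set R) := by
    intro c hc
    have := hcon c hc
    simp only [Rcirc, Set.mem_ofPred_eq, not_forall, not_not] at this
    obtain ⟨P, hP, hcP⟩ := this
    simp only [Set.mem_iUnion]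
    exact ⟨P, by simpa using hP, hcP⟩
  have := (Ideal.subset_union_prime (f := fun P : Ideal R => P) ⊥ ⊥ (fun P hP _ _ =>
    Ideal.IsMinimalPrime.isPrime (by simpa using hP))).1 this
  obtain ⟨P, hP, hIP⟩ := this
  exact hI P (by simpa using hP) hIP

theorem exists_dual_basis {R : Type u} [CommRing R] [IsNoetherianRing R] [IsReduced R]
    (M : Type u) [AddCommGroup M] [Module R M] [Module.Finite R M] :
    ∃ c ∈ Rcirc R, ∃ (n : ℕ) (φ : Fin n → (M →ₗ[R] R)) (x : Fin n → M),
      ∀ y, c • y = ∑ i, φ i y • x i := by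
  obtain ⟨n, π, hπ⟩ := Module.Finite.exists_fin' R M
  let D : Ideal R := 
    { carrier := {c | ∃ h : M →ₗ[R] (Fin n → R), ∀ y, π (h y) = c • y}
      add_mem' := by
        rintro c d ⟨h, hh⟩ ⟨k, hk⟩
        exact ⟨h + k, fun y => by simp [hh, hk, add_smul]⟩
      zero_mem' := ⟨0, fun y => by simp⟩
      smul_mem' := by
        rintro r c ⟨h, hh⟩
        exact ⟨r • h, fun y => by simp [hh, mul_smul]⟩ }
  obtain ⟨c, ⟨h, hh⟩, hc⟩ := exists_mem_Rcirc D (by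
    intro P hP hle
    have hPp : P.IsPrime := Ideal.IsMinimalPrime.isPrime hP
    let S := P.primeCompl
    let K := Localization.AtPrime P
    have : Ring.KrullDimLE 0 K := Ring.KrullDimLE.of_isLocalization P hP K
    have : IsArtinianRing K := by
      rw [isArtinianRing_iff_krullDimLE_zero]; infer_instance
    have : IsReduced K := by infer_instance
    have : IsSemisimpleRing K := IsArtinianRing.isSemisimpleRing_of_isReduced K
    let F := Fin n → R
    let fF := LocalizedModule.mkLinearMap S F
    let fM := LocalizedModule.mkLinearMap S M
    have : Module.Projective K (LocalizedModule S M) := Module.projective_of_isSemisimpleRing K _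
    let πP := IsLocalizedModule.mapExtendScalars S fF fM K π
    have hπP : Function.Surjective πP := IsLocalizedModule.map_surjective S fF fM π hπ
    obtain ⟨σ, hσ⟩ := Module.projective_lifting_property πP LinearMap.id hπP
    have : Module.FinitePresentation R M := Module.finitePresentation_of_finite R M
    obtain ⟨h', s, hs⟩ := Module.FinitePresentation.exists_lift_of_isLocalizedModule S fF
      ((σ.restrictScalars R).comp fM)
    obtain ⟨s', hs'⟩ := Module.Finite.exists_smul_of_comp_eq_of_isLocalizedModule S fM
      (π.comp h') (s.1 • LinearMap.id) (by
        ext y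
        have h1 : πP (fF (h' y)) = fM (π (h' y)) := IsLocalizedModule.map_apply S fF fM π _
        have h2 : fF (h' y) = s.1 • σ (fM y) := LinearMap.congr_fun hs y
        have h3 : πP (σ (fM y)) = fM y := LinearMap.congr_fun hσ _
        simp only [LinearMap.comp_apply, LinearMap.smul_apply, LinearMap.id_apply]
        rw [← h1, h2, map_smul fM]
        have : πP (s.1 • σ (fM y)) = s.1 • πP (σ (fM y)) := (πP.restrictScalars R).map_smul _ _
        rw [this, h3])
    have hmem : (s'.1 * s.1) ∈ D := by
      refine ⟨s'.1 • h', fun y => ?_⟩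
      have := LinearMap.congr_fun hs' y
      simp only [LinearMap.smul_apply, LinearMap.comp_apply, LinearMap.id_apply] at this
      simp only [LinearMap.smul_apply, map_smul, mul_smul]
      exact this
    exact (s' * s).2 (hle hmem))
  refine ⟨c, hc, n, fun i => (LinearMap.proj i).comp h, fun i => π (Pi.single i 1), fun y => ?_⟩
  rw [← hh]
  conv_lhs => rw [show h y = ∑ i, h y i • (Pi.single i (1:R) : Fin n → R) by
      ext k; simp [Finset.sum_apply, Pi.single_apply]]
  simp [map_sum]

/-- `φ` is a `p^{-e}`-linear map `R → R`. -/
def IsCart {R : Type u} [CommRing R] (p e : ℕ) (φ : R →+ R) : Prop :=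
  ∀ r x, φ (r ^ p ^ e * x) = r * φ x

theorem IsCart.comp {R : Type u} [CommRing R] {p e k : ℕ} {φ ψ : R →+ R}
    (hφ : IsCart p e φ) (hψ : IsCart p k ψ) : IsCart p (e + k) (φ.comp ψ) := by
  intro r x
  simp only [AddMonoidHom.comp_apply]
  rw [pow_add, pow_mul, hψ, hφ]

theorem IsCart.mulLeft {R : Type u} [CommRing R] {p e : ℕ} {φ : R →+ R}
    (hφ : IsCart p e φ) (c : R) : IsCart p e ((AddMonoidHom.mulLeft c).comp φ) := by
  intro r x
  simp only [AddMonoidHom.comp_apply, AddMonoidHom.coe_mulLeft]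
  rw [hφ]; ring

theorem IsCart.mulRight {R : Type u} [CommRing R] {p e : ℕ} {φ : R →+ R}
    (hφ : IsCart p e φ) (c : R) : IsCart p e (φ.comp (AddMonoidHom.mulLeft c)) := by
  intro r x
  simp only [AddMonoidHom.comp_apply, AddMonoidHom.coe_mulLeft]
  rw [← hφ]; congr 1; ring

theorem isCart_id {R : Type u} [CommRing R] (p : ℕ) : IsCart p 0 (AddMonoidHom.id R) := by
  intro r x; simp

theorem smul_of {R : Type u} [CommRing R] (p e : ℕ) [ExpChar R p] (r y : R) :
    r • FrobAlg.of R p e y = FrobAlg.of R p e (r ^ p ^ e * y) := by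
  rw [Algebra.smul_def, map_mul]
  congr 1

/-- Linear functional to Cartier map. -/
theorem isCart_of_linear {R : Type u} [CommRing R] (p e : ℕ) [ExpChar R p]
    (f : FrobAlg R p e →ₗ[R] R) :
    IsCart p e (f.toAddMonoidHom.comp (FrobAlg.of R p e).toAddMonoidHom) := by
  intro r x
  change f (FrobAlg.of R p e (r ^ p ^ e * x)) = r * f (FrobAlg.of R p e x)
  rw [← smul_of, map_smul, smul_eq_mul]

theorem exists_linear_of_isCart {R : Type u} [CommRing R] (p e : ℕ) [ExpChar R p]
    (φ : R →+ R) (hφ : IsCart p e φ) :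
    ∃ f : FrobAlg R p e →ₗ[R] R, ∀ x, f (FrobAlg.of R p e x) = φ x :=
  ⟨{ toFun := fun x => φ x
     map_add' := fun x y => φ.map_add x y
     map_smul' := fun r x => by
      have : r • x = FrobAlg.of R p e (r ^ p ^ e * (show R from x)) := smul_of p e r x
      rw [this]
      exact hφ r x }, fun x => rfl⟩

theorem frob_finite {R : Type u} [CommRing R] (p : ℕ) [ExpChar R p] (h : IsFFinite R p) (e : ℕ) :
    Module.Finite R (FrobAlg R p e) := by
  have h1 : (frobenius R p).Finite := by
    have h' : ((FrobAlg.of R p 1).comp (iterateFrobenius R p 1)).Finite := h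
    have : (FrobAlg.of R p 1).comp (iterateFrobenius R p 1) = frobenius R p := by
      ext x
      change iterateFrobenius R p 1 x = (frobenius R p : R →+* R) x
      exact iterateFrobenius_one_apply R p x
    rw [← this]
    exact h'
  have h2 : ∀ e, (iterateFrobenius R p e).Finite := by
    intro e
    induction e with
    | zero => 
      rw [iterateFrobenius_zero]; exact RingHom.Finite.id R
    | succ e ih =>
      have : iterateFrobenius R p (e + 1) = (frobenius R p).comp (iterateFrobenius R p e) := by
        ext x
        rw [RingHom.comp_apply, iterateFrobenius_def, iterateFrobenius_def, frobenius_def, pow_succ,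
          pow_mul]
      rw [this]
      exact h1.comp ih
  exact h2 e

theorem tmul_zero_iff {R : Type u} [CommRing R] [IsNoetherianRing R] (p : ℕ) [ExpChar R p]
    (h : IsFFinite R p) {E : Type u} [AddCommGroup E] [Module R E] (hE : Module.Injective R E)
    (e : ℕ) (y : R) (z : E) :
    (FrobAlg.of R p e y) ⊗ₜ[R] z = (0 : TensorProduct R (FrobAlg R p e) E) ↔
      ∀ φ : R →+ R, IsCart p e φ → φ y • z = 0 := by
  have := frob_finite p h e
  constructor
  · intro h0 φ hφ
    obtain ⟨f, hf⟩ := exists_linear_of_isCart p e φ hφ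
    have := congrArg (fun w => TensorProduct.lid R E (LinearMap.rTensor E f w)) h0
    simpa [hf] using this
  · intro h0
    exact tmul_eq_zero_of_dual hE _ _ fun f => h0 _ (isCart_of_linear p e f)

theorem exists_cart_basis {R : Type u} [CommRing R] [IsNoetherianRing R] [IsReduced R]
    (p : ℕ) [ExpChar R p] (h : IsFFinite R p) :
    ∃ c ∈ Rcirc R, ∃ (n : ℕ) (φ : Fin n → (R →+ R)) (x : Fin n → R),
      (∀ i, IsCart p 1 (φ i)) ∧ ∀ y, c ^ p * y = ∑ i, φ i y ^ p * x i := by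
  have : Module.Finite R (FrobAlg R p 1) := h
  obtain ⟨c, hc, n, f, x, hx⟩ := exists_dual_basis (R := R) (FrobAlg R p 1)
  refine ⟨c, hc, n, _, x, fun i => isCart_of_linear p 1 (f i), fun y => ?_⟩
  have h1 := hx (FrobAlg.of R p 1 y)
  rw [smul_of, pow_one] at h1
  refine h1.trans (Finset.sum_congr rfl fun i _ => ?_)
  have := smul_of p 1 (f i (FrobAlg.of R p 1 y)) (x i)
  rw [pow_one] at this
  exact this

/-- The ideal generated by the images of `d` under all `p^{-e}`-linear maps, `e ≥ e₀`. -/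
def cartIdeal {R : Type u} [CommRing R] (p : ℕ) (d : R) (e₀ : ℕ) : Ideal R :=
  Ideal.span {w | ∃ e, e₀ ≤ e ∧ ∃ φ : R →+ R, IsCart p e φ ∧ w = φ d}

theorem eq_zero_of_mul_Rcirc {R : Type u} [CommRing R] [IsReduced R] {d s : R}
    (hd : d ∈ Rcirc R) (h : s * d = 0) : s = 0 := by
  have : s ∈ sInf (minimalPrimes R) := by
    rw [Submodule.mem_sInf]
    intro P hP
    have hPp : Ideal.IsPrime P := Ideal.IsMinimalPrime.isPrime hP
    exact (hPp.mem_or_mem (h ▸ P.zero_mem : s * d ∈ P)).resolve_right (hd P hP)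
  rw [minimalPrimes, Ideal.sInf_minimalPrimes] at this
  obtain ⟨n, hn⟩ := this
  exact (show IsNilpotent s from ⟨n, hn⟩).eq_zero

theorem Rcirc_pow {R : Type u} [CommRing R] {c : R} (hc : c ∈ Rcirc R) (n : ℕ) :
    c ^ n ∈ Rcirc R := fun P hP h => 
  hc P hP ((Ideal.IsMinimalPrime.isPrime hP).mem_of_pow_mem n h)

theorem Rcirc_mul {R : Type u} [CommRing R] {c d : R} (hc : c ∈ Rcirc R) (hd : d ∈ Rcirc R) :
    c * d ∈ Rcirc R := fun P hP h => 
  ((Ideal.IsMinimalPrime.isPrime hP).mem_or_mem h).elim (hc P hP) (hd P hP)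

theorem exists_test {R : Type u} [CommRing R] [IsNoetherianRing R] [IsReduced R]
    (p : ℕ) [Fact p.Prime] [ExpChar R p] (h : IsFFinite R p) :
    ∃ c ∈ Rcirc R, ∀ d ∈ Rcirc R, ∀ e₀, c ∈ cartIdeal p d e₀ := by
  have hp : 2 ≤ p := (Fact.out : p.Prime).two_le
  obtain ⟨c, hc, n, φ, x, hφ, hx⟩ := exists_cart_basis p h
  obtain ⟨φ₀, hφ₀, hφ₀1⟩ : ∃ φ₀ : R →+ R, IsCart p 1 φ₀ ∧ φ₀ 1 = c ^ p := by
    refine ⟨∑ i, (AddMonoidHom.mulLeft (φ i 1 ^ (p - 1) * x i)).comp (φ i), ?_, ?_⟩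
    · intro r y
      simp only [AddMonoidHom.finsetSum_apply]
      rw [Finset.mul_sum]
      exact Finset.sum_congr rfl fun i _ => (hφ i).mulLeft _ r y
    · have := hx 1
      rw [mul_one] at this
      rw [this]
      simp only [AddMonoidHom.finsetSum_apply, AddMonoidHom.comp_apply, AddMonoidHom.coe_mulLeft]
      refine Finset.sum_congr rfl fun i _ => ?_
      obtain ⟨k, rfl⟩ : ∃ k, p = k + 1 := ⟨p - 1, by omega⟩
      simp only [Nat.add_sub_cancel]
      ring
  have hψ : ∀ e, ∃ ψ : R →+ R, IsCart p e ψ ∧ ψ 1 = (c ^ p) ^ 2 := by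
    intro e
    induction e with
    | zero => exact ⟨_, (isCart_id p).mulLeft ((c ^ p) ^ 2), by simp⟩
    | succ e ih =>
      obtain ⟨ψ, h1, h2⟩ := ih
      refine ⟨φ₀.comp ((AddMonoidHom.mulLeft ((c ^ p) ^ (p - 2))).comp ψ), ?_, ?_⟩
      · rw [add_comm]
        exact hφ₀.comp (h1.mulLeft _)
      · simp only [AddMonoidHom.comp_apply, AddMonoidHom.coe_mulLeft]
        rw [h2, ← pow_add, Nat.sub_add_cancel hp]
        have := hφ₀ (c ^ p) 1
        rw [pow_one, mul_one] at this
        rw [this, hφ₀1]; ring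
  refine ⟨(c ^ p) ^ 3, Rcirc_pow (Rcirc_pow hc _) _, fun d hd e₀ => ?_⟩
  have hrad : c ∈ (cartIdeal p d 0).radical := by
    rw [Ideal.radical_eq_sInf, Submodule.mem_sInf]
    rintro (P : Ideal R) ⟨hJP, hP⟩
    by_contra hcP
    have step : ∀ e y, (∀ ψ : R →+ R, IsCart p e ψ → ψ y ∈ P) →
        ∃ N, c ^ N * y ∈ P ^ p ^ e := by
      intro e
      induction e with
      | zero => 
        intro y hy
        exact ⟨0, by simpa using hy _ (isCart_id p)⟩
      | succ e ih =>
        intro y hy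
        have : ∀ i, ∃ N, c ^ N * φ i y ∈ P ^ p ^ e := fun i =>
          ih _ fun ψ hψ => hy _ (hψ.comp (hφ i))
        choose N hN using this
        have hN' : ∀ i, c ^ (∑ j, N j) * φ i y ∈ P ^ p ^ e := by
          intro i
          rw [← Nat.sub_add_cancel (Finset.single_le_sum (fun j _ => Nat.zero_le (N j)) (Finset.mem_univ i)), pow_add, mul_assoc]
          exact Ideal.mul_mem_left _ _ (hN i)
        refine ⟨(∑ j, N j) * p + p, ?_⟩
        rw [pow_add c, mul_assoc, hx, Finset.mul_sum]
        refine Ideal.sum_mem _ fun i _ => ?_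
        rw [pow_mul, ← mul_assoc, ← mul_pow, pow_succ, pow_mul]
        exact Ideal.mul_mem_right _ _ (Ideal.pow_mem_pow (hN' i) p)
    have hd0 : algebraMap R (Localization.AtPrime P) d ∈
        (⨅ k, IsLocalRing.maximalIdeal (Localization.AtPrime P) ^ k : Ideal _) := by
      rw [Submodule.mem_iInf]
      intro k
      obtain ⟨N, hN⟩ := step k d fun ψ hψ => hJP (Ideal.subset_span ⟨k, Nat.zero_le _, ψ, hψ, rfl⟩)
      have h1 := Ideal.mem_map_of_mem (algebraMap R (Localization.AtPrime P)) hN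
      rw [Ideal.map_pow, Localization.AtPrime.map_eq_maximalIdeal, map_mul, map_pow] at h1
      have hu : IsUnit (algebraMap R (Localization.AtPrime P) c ^ N) :=
        (IsLocalization.map_units (Localization.AtPrime P) (⟨c, hcP⟩ : P.primeCompl)).pow N
      have h2 := (Ideal.unit_mul_mem_iff_mem _ hu).1 h1
      exact Ideal.pow_le_pow_right (Nat.lt_pow_self (by omega)).le h2
    rw [Ideal.iInf_pow_eq_bot_of_isLocalRing _ (IsLocalRing.maximalIdeal.isMaximal _).ne_top,
      Ideal.mem_bot, IsLocalization.map_eq_zero_iff P.primeCompl] at hd0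
    obtain ⟨s, hs⟩ := hd0
    exact s.2 (eq_zero_of_mul_Rcirc hd hs ▸ P.zero_mem)
  obtain ⟨N, hN⟩ := hrad
  obtain ⟨ψ, hψ1, hψ2⟩ := hψ (max e₀ N)
  have h3 : ψ ((c ^ p) ^ p ^ max e₀ N * 1) = (c ^ p) ^ 3 := by
    rw [hψ1, hψ2]; ring
  rw [← h3, mul_one]
  have hmem : (c ^ p) ^ p ^ max e₀ N ∈ cartIdeal p d 0 := by
    have hle : N ≤ p ^ max e₀ N :=
      (le_max_right e₀ N).trans (Nat.lt_pow_self (by omega)).le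
    rw [← pow_mul]
    rw [← Nat.sub_add_cancel (hle.trans (Nat.le_mul_of_pos_left _ (Fact.out : p.Prime).pos)), pow_add]
    exact Ideal.mul_mem_left _ _ hN
  have hall : ∀ w ∈ cartIdeal p d 0, ∀ r, ψ (r * w) ∈ cartIdeal p d e₀ := by
    intro w hw
    refine Submodule.span_induction ?_ ?_ ?_ ?_ hw
    · rintro _ ⟨e, -, θ, hθ, rfl⟩ r
      exact Ideal.subset_span ⟨_, (le_max_left e₀ N).trans (Nat.le_add_right _ e), _,
        (hψ1.mulRight r).comp hθ, rfl⟩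
    · intro r; simp
    · intro a b _ _ ha hb r
      rw [mul_add, map_add]; exact Ideal.add_mem _ (ha r) (hb r)
    · intro s a _ ha r
      rw [smul_eq_mul, ← mul_assoc]; exact ha _
  simpa using hall _ hmem 1

/-- The graded family of ideals `a^{sq} b^{⌈tq⌉}`. -/
def expIdeal {R : Type u} [CommRing R] (p : ℕ) (a b : Ideal R) (s : ℕ) (t : ℚ) (e : ℕ) : Ideal R :=
  a ^ (s * p ^ e) * b ^ ⌈t * (p : ℚ) ^ e⌉₊

theorem pow_mem_expIdeal {R : Type u} [CommRing R] (p : ℕ) (a b : Ideal R) (s : ℕ)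
    (t : ℚ) (e k : ℕ) {x : R} (hx : x ∈ expIdeal p a b s t e) :
    x ^ p ^ k ∈ expIdeal p a b s t (e + k) := by
  have h1 := Ideal.pow_mem_pow hx (p ^ k)
  rw [expIdeal, mul_pow, ← pow_mul, ← pow_mul] at h1
  refine Ideal.mul_mono (Ideal.pow_le_pow_right ?_) (Ideal.pow_le_pow_right ?_) h1
  · rw [pow_add, mul_assoc]
  · apply Nat.ceil_le.2
    push_cast
    rw [pow_add, ← mul_assoc]
    gcongr
    exact Nat.le_ceil _

/-- The ideal cutting out the tight closure of zero in `E`. -/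
def tauIdeal {R : Type u} [CommRing R] (p : ℕ) (a b : Ideal R) (s : ℕ) (t : ℚ) (c : R) : Ideal R :=
  Ideal.span {w | ∃ e, ∃ φ : R →+ R, IsCart p e φ ∧ ∃ x ∈ expIdeal p a b s t e, w = φ (c * x)}

theorem tauIdeal_iff {R : Type u} [CommRing R] [IsNoetherianRing R]
    (p : ℕ) [ExpChar R p] (h : IsFFinite R p)
    {E : Type u} [AddCommGroup E] [Module R E] (hE : Module.Injective R E)
    (a b : Ideal R) (s : ℕ) (t : ℚ) {c : R} (z : E) :
    (∀ w ∈ tauIdeal p a b s t c, w • z = 0) ↔ ∀ e, ∀ x ∈ expIdeal p a b s t e,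
      (FrobAlg.of R p e (c * x)) ⊗ₜ[R] z = (0 : TensorProduct R (FrobAlg R p e) E) := by
  constructor
  · intro hz e x hx
    rw [tmul_zero_iff p h hE]
    intro φ hφ
    exact hz _ (Ideal.subset_span ⟨e, φ, hφ, x, hx, rfl⟩)
  · intro hz w hw
    refine Submodule.span_induction ?_ ?_ ?_ ?_ hw
    · rintro _ ⟨e, φ, hφ, x, hx, rfl⟩
      exact (tmul_zero_iff p h hE e _ z).1 (hz e x hx) φ hφ
    · simp
    · intro u v _ _ hu hv
      rw [add_smul, hu, hv, add_zero]
    · intro r u _ hu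
      rw [smul_assoc, hu, smul_zero]

theorem moduleTC2_iff {R : Type u} [CommRing R] [IsNoetherianRing R]
    (p : ℕ) [ExpChar R p] (h : IsFFinite R p)
    {E : Type u} [AddCommGroup E] [Module R E] (hE : Module.Injective R E)
    (a b : Ideal R) (s : ℕ) (t : ℚ) {c : R} (hc : c ∈ Rcirc R)
    (htest : ∀ d ∈ Rcirc R, ∀ e₀, c ∈ cartIdeal p d e₀) (z : E) :
    z ∈ moduleTC2 R p a b s t E ↔ ∀ w ∈ tauIdeal p a b s t c, w • z = 0 := by
  constructor
  · rintro ⟨d, hd, e₀, hz⟩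
    rw [tauIdeal_iff p h hE]
    intro e x hx
    rw [tmul_zero_iff p h hE]
    intro φ hφ
    have : ∀ w ∈ cartIdeal p d e₀, ∀ r, φ (r * (w * x)) • z = 0 := by
      intro w hw
      refine Submodule.span_induction ?_ ?_ ?_ ?_ hw
      · rintro _ ⟨k, hk, ψ, hψ, rfl⟩ r
        have h1 := (tmul_zero_iff p h hE (e + k) _ z).1
          (hz (e + k) (hk.trans (Nat.le_add_left _ _)) _ (pow_mem_expIdeal p a b s t e k hx)) _
          ((hφ.mulRight r).comp hψ)
        simp only [AddMonoidHom.comp_apply, AddMonoidHom.coe_mulLeft] at h1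
        rw [mul_comm d, hψ, mul_comm x] at h1
        exact h1
      · intro r; simp
      · intro u v _ _ hu hv r
        rw [add_mul, mul_add, map_add, add_smul, hu, hv, add_zero]
      · intro q u _ hu r
        rw [smul_eq_mul, mul_assoc, ← mul_assoc]
        exact hu _
    simpa using this c (htest d hd e₀) 1
  · intro hz
    exact ⟨c, hc, 0, fun e _ => (tauIdeal_iff p h hE a b s t z).1 hz e⟩

theorem tildeTau2_eq {R : Type u} [CommRing R] (p : ℕ) [ExpChar R p]
    {E : Type u} [AddCommGroup E] [Module R E]
    (a b : Ideal R) (s : ℕ) (t : ℚ) [IsLocalRing R]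
    (hE : IsInjectiveHull R (R ⧸ IsLocalRing.maximalIdeal R) E) (J : Ideal R)
    (hJ : ∀ z : E, z ∈ moduleTC2 R p a b s t E ↔ ∀ w ∈ J, w • z = 0) :
    tildeTau2 R p a b s t E = J := by
  apply le_antisymm
  · intro r hr
    refine mem_of_annihilates hE J r fun z hz => ?_
    exact Submodule.mem_annihilator.1 hr z (Submodule.subset_span ((hJ z).2 hz))
  · intro r hr
    rw [tildeTau2, Submodule.mem_annihilator_span]
    rintro ⟨z, hz⟩
    exact (hJ z).1 hz r hr

/-- Pigeonhole. -/
theorem span_pow_le {R : Type u} [CommRing R] (l : ℕ) (hl : 0 < l) (x : Fin l → R) (q : ℕ) :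
    Ideal.span (Set.range x) ^ (l * q) ≤
      Ideal.span (Set.range fun i => x i ^ q) * Ideal.span (Set.range x) ^ ((l - 1) * q) := by
  rw [Ideal.span, Submodule.span_pow, Submodule.span_le]
  intro w hw
  rw [Set.mem_pow_iff_prod] at hw
  obtain ⟨f, hf, rfl⟩ := hw
  choose g hg using hf
  haveI : Nonempty (Fin l) := ⟨⟨0, hl⟩⟩
  obtain ⟨i, hi⟩ := Fintype.exists_le_card_fiber_of_mul_le_card (f := g) (n := q) (by simp)
  obtain ⟨T, hT, hTc⟩ := Finset.exists_subset_card_eq hi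
  rw [← Finset.prod_mul_prod_compl T]
  apply Ideal.mul_mem_mul
  · apply Ideal.subset_span
    refine ⟨i, ?_⟩
    have : ∏ j ∈ T, f j = ∏ j ∈ T, x i := by
      refine Finset.prod_congr rfl fun j hj => ?_
      have := (Finset.mem_filter.1 (hT hj)).2
      rw [← hg, this]
    rw [this, Finset.prod_const, hTc]
  · have hcard : (l - 1) * q = Tᶜ.card := by
      rw [Finset.card_compl, hTc, Fintype.card_fin, Nat.sub_mul, one_mul]
    rw [hcard]
    rw [← Finset.prod_const]
    exact Ideal.prod_mem_prod fun j _ => Ideal.subset_span ⟨g j, hg j⟩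

theorem pow_add_of_reduction {R : Type u} [CommRing R] {a q : Ideal R} {n : ℕ}
    (h : a ^ (n + 1) = q * a ^ n) (k : ℕ) : a ^ n * a ^ k = q ^ k * a ^ n := by
  induction k with
  | zero => simp
  | succ k ih =>
    calc a ^ n * a ^ (k + 1) = (a ^ n * a ^ k) * a := by rw [pow_succ, mul_assoc]
      _ = q ^ k * a ^ (n + 1) := by rw [ih, pow_succ, mul_assoc]
      _ = q ^ (k + 1) * a ^ n := by rw [h, pow_succ, mul_assoc]

/-- **Theorem 4.2 (Skoda-type theorem, F-finite version)** (Hara–Takagi).  `(R,m)` an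
F-finite reduced (excellent) local ring of characteristic `p > 0`, `a` an ideal of positive
height with a reduction generated by `l` elements, `b ∩ R° ≠ ∅`, `t ≥ 0` rational; if
condition `(*)` holds for `aˡ⁻¹·bᵗ` and `aˡ·bᵗ`, then `τ(aˡ·bᵗ) = τ(aˡ⁻¹·bᵗ)·a`. -/
theorem skoda_theorem_F_finite
    (p : ℕ) [Fact p.Prime] [CharP R p] [ExpChar R p]
    [IsNoetherianRing R] [IsReduced R] [IsLocalRing R]
    (hFF : IsFFinite R p)
    (a : Ideal R) (hht : ∀ P ∈ minimalPrimes R, ¬ a ≤ P)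
    (l : ℕ)
    (hred : ∃ q : Ideal R, q ≤ a ∧ (∃ x : Fin l → R, Ideal.span (Set.range x) = q) ∧
      ∃ n : ℕ, a ^ (n + 1) = q * a ^ n)
    (b : Ideal R) (hb : ((b : Set R) ∩ Rcirc R).Nonempty)
    (t : ℚ) (ht : 0 ≤ t)
    (E : Type u) [AddCommGroup E] [Module R E]
    (hE : IsInjectiveHull R (R ⧸ IsLocalRing.maximalIdeal R) E)
    (hstar₁ : testIdeal2 R p a b (l - 1) t = tildeTau2 R p a b (l - 1) t E)
    (hstar₂ : testIdeal2 R p a b l t = tildeTau2 R p a b l t E) :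
    testIdeal2 R p a b l t = testIdeal2 R p a b (l - 1) t * a := by
  obtain ⟨q, hqa, ⟨x, hx⟩, n, hn⟩ := hred
  have hl : 0 < l := by
    rcases Nat.eq_zero_or_pos l with rfl | hl
    · exfalso
      have hq : q = ⊥ := by rw [← hx]; simp [Set.range_eq_empty]
      rw [hq] at hn
      obtain ⟨P, hP, -⟩ := Ideal.exists_minimalPrimes_le
        (bot_le : (⊥ : Ideal R) ≤ IsLocalRing.maximalIdeal R)
      have hPp : P.IsPrime := Ideal.IsMinimalPrime.isPrime hP
      refine hht P hP (hPp.le_of_pow_le (n := n + 1) ?_)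
      rw [hn]; simp
    · exact hl
  obtain ⟨s, rfl⟩ : ∃ s, l = s + 1 := ⟨l - 1, by omega⟩
  simp only [Nat.add_sub_cancel] at *
  have hinj := hE.1
  obtain ⟨c, hc, htest⟩ := exists_test p hFF
  rw [hstar₁, hstar₂]
  have hs := moduleTC2_iff p hFF hinj a b s t hc htest
  rw [tildeTau2_eq p a b s t hE _ hs]
  apply tildeTau2_eq p a b (s + 1) t hE
  have hcolon : ∀ z : E, (∀ w ∈ tauIdeal p a b s t c * a, w • z = 0) ↔
      ∀ y ∈ a, y • z ∈ moduleTC2 R p a b s t E := by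
    intro z
    constructor
    · intro hz y hy
      rw [hs]
      intro w hw
      rw [smul_smul]
      exact hz _ (Ideal.mul_mem_mul hw hy)
    · intro hz w hw
      refine Submodule.mul_induction_on hw ?_ ?_
      · intro u hu v hv
        rw [mul_smul]
        exact (hs _).1 (hz v hv) u hu
      · intro u v hu hv
        rw [add_smul, hu, hv, add_zero]
  intro z
  rw [hcolon]
  constructor
  · rintro ⟨d, hd, e₀, hz⟩ y hy
    refine ⟨d, hd, e₀, fun e he w hw => ?_⟩
    rw [← TensorProduct.smul_tmul, smul_of]
    have : y ^ p ^ e * (d * w) = d * (y ^ p ^ e * w) := by ring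
    rw [this]
    apply hz e he
    have h1 := Ideal.mul_mem_mul (Ideal.pow_mem_pow hy (p ^ e)) hw
    rw [← mul_assoc, ← pow_add] at h1
    rwa [add_mul, one_mul, add_comm]
  · intro hz
    obtain ⟨d, hd, hdc⟩ := exists_mem_Rcirc (a ^ n) (by
      intro P hP hle
      have hPp : P.IsPrime := Ideal.IsMinimalPrime.isPrime hP
      exact hht P hP (hPp.le_of_pow_le hle))
    refine ⟨c * d, Rcirc_mul hc hdc, 0, fun e _ w hw => ?_⟩
    let W : Ideal R :=
      { carrier := {w | (FrobAlg.of R p e (c * w)) ⊗ₜ[R] z =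
          (0 : TensorProduct R (FrobAlg R p e) E)}
        add_mem' := by
          intro u v hu hv
          simp only [Set.mem_ofPred_eq] at *
          rw [mul_add, map_add, TensorProduct.add_tmul, hu, hv, add_zero]
        zero_mem' := by simp
        smul_mem' := by
          intro r u hu
          simp only [Set.mem_ofPred_eq, smul_eq_mul] at *
          have := congrArg (fun w => FrobAlg.of R p e r • w) hu
          simp only [smul_zero, TensorProduct.smul_tmul', smul_eq_mul, ← map_mul] at this
          rw [← this]
          congr 2
          ring }
    have hW : Ideal.span (Set.range fun i => x i ^ p ^ e) * expIdeal p a b s t e ≤ W := by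
      rw [Ideal.mul_le]
      intro u hu v hv
      refine Submodule.span_induction ?_ ?_ ?_ ?_ hu
      · rintro _ ⟨i, rfl⟩
        have hxi : x i ∈ a := hqa (hx ▸ Ideal.subset_span ⟨i, rfl⟩)
        have h1 := (tauIdeal_iff p hFF hinj a b s t _).1 ((hs _).1 (hz _ hxi)) e v hv
        rw [← TensorProduct.smul_tmul, smul_of] at h1
        change (FrobAlg.of R p e (c * (x i ^ p ^ e * v))) ⊗ₜ[R] z =
          (0 : TensorProduct R (FrobAlg R p e) E)
        rw [← h1]
        congr 2
        ring
      · simp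
      · intro u₁ u₂ _ _ h1 h2
        rw [add_mul]; exact W.add_mem h1 h2
      · intro r u₁ _ h1
        rw [smul_eq_mul, mul_assoc]; exact W.mul_mem_left r h1
    have hmem : d * w ∈ W := by
      apply hW
      have h1 := Ideal.mul_mem_mul hd hw
      rw [← mul_assoc, pow_add_of_reduction hn] at h1
      have h2 := span_pow_le (s + 1) hl x (p ^ e)
      rw [hx] at h2
      simp only [Nat.add_sub_cancel] at h2
      refine (show q ^ ((s + 1) * p ^ e) * a ^ n * b ^ ⌈t * (p : ℚ) ^ e⌉₊ ≤ _ from ?_) h1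
      calc q ^ ((s + 1) * p ^ e) * a ^ n * b ^ ⌈t * (p : ℚ) ^ e⌉₊
          ≤ (Ideal.span (Set.range fun i => x i ^ p ^ e) * q ^ (s * p ^ e)) * ⊤ *
            b ^ ⌈t * (p : ℚ) ^ e⌉₊ := by gcongr; exact le_top
        _ = Ideal.span (Set.range fun i => x i ^ p ^ e) * (q ^ (s * p ^ e) *
            b ^ ⌈t * (p : ℚ) ^ e⌉₊) := by rw [Ideal.mul_top, mul_assoc]
        _ ≤ _ := by
          unfold expIdeal
          gcongr
    rw [mul_assoc]
    exact hmem
end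

section
/- Let (R,m) be a complete Noetherian reduced local ring of prime characteristic p > 0, and let a ⊆ R be an ideal of positive height possessing a reduction generated by l elements. Then τ(a^{n+l-1}) ⊆ a^n for all integers n ≥ 0. -/
open scoped TensorProduct

universe u

variable (R : Type u) [CommRing R]

section Helpers

variable {R}

/-- Powers of a finitely generated ideal are spanned by monomials. -/
theorem span_range_pow_le_monomials {l : ℕ} (x : Fin l → R) (m : ℕ) :
    (Ideal.span (Set.range x)) ^ m ≤
      Ideal.span {y : R | ∃ f : Fin l → ℕ, ∑ i, f i = m ∧ y = ∏ i, x i ^ f i} := by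
  induction m with
  | zero =>
    rw [pow_zero, Ideal.one_eq_top, top_le_iff, Ideal.eq_top_iff_one]
    refine Ideal.subset_span ?_
    exact ⟨fun _ => 0, by simp, by simp⟩
  | succ m ih =>
    rw [pow_succ]
    refine (Ideal.mul_mono_left ih).trans ?_
    rw [Ideal.span_mul_span', Ideal.span_le]
    rintro _ ⟨y, ⟨f, hf, rfl⟩, _, ⟨j, rfl⟩, rfl⟩
    refine Ideal.subset_span ?_
    refine ⟨f + Pi.single j 1, ?_, ?_⟩
    · simp [Finset.sum_add_distrib, hf]
    · simp only [Pi.add_apply, pow_add, Finset.prod_mul_distrib]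
      congr 1
      rw [Finset.prod_eq_single j]
      · simp
      · intro b _ hb
        simp [Pi.single_eq_of_ne hb]
      · simp

theorem monomial_mem_pow {l : ℕ} (x : Fin l → R) (f : Fin l → ℕ) :
    ∏ i, x i ^ f i ∈ (Ideal.span (Set.range x)) ^ (∑ i, f i) := by
  rw [← Finset.prod_pow_eq_pow_sum]
  exact Ideal.prod_mem_prod fun i _ =>
    Ideal.pow_mem_pow (Ideal.subset_span (Set.mem_range_self i)) _

theorem span_pow_le_frobPow {l : ℕ} (hl : 0 < l) (x : Fin l → R) (n Q : ℕ) (hQ : 0 < Q) :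
    (Ideal.span (Set.range x)) ^ ((n + l - 1) * Q) ≤
      frobPow R ((Ideal.span (Set.range x)) ^ n) Q := by
  refine (span_range_pow_le_monomials x _).trans ?_
  rw [Ideal.span_le]
  rintro _ ⟨f, hf, rfl⟩
  have hsplit : ∏ i, x i ^ f i = (∏ i, x i ^ (f i % Q)) * (∏ i, x i ^ (f i / Q)) ^ Q := by
    rw [← Finset.prod_pow, ← Finset.prod_mul_distrib]
    refine Finset.prod_congr rfl fun i _ => ?_
    rw [← pow_mul, ← pow_add, mul_comm (f i / Q), Nat.mod_add_div]
  have hn : n ≤ ∑ i, f i / Q := by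
    have h1 : ∑ i, f i ≤ ∑ i : Fin l, (Q * (f i / Q) + (Q - 1)) := by
      refine Finset.sum_le_sum fun i _ => ?_
      have := Nat.mod_add_div (f i) Q
      have := Nat.mod_lt (f i) hQ
      omega
    rw [Finset.sum_add_distrib, ← Finset.mul_sum, hf] at h1
    simp only [Finset.sum_const, Finset.card_univ, Fintype.card_fin, smul_eq_mul] at h1
    by_contra hlt
    obtain ⟨k, rfl⟩ : ∃ k, l = k + 1 := ⟨l - 1, by omega⟩
    obtain ⟨Q', rfl⟩ : ∃ k, Q = k + 1 := ⟨Q - 1, by omega⟩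
    have h2 : ∑ i, f i / (Q' + 1) + 1 ≤ n := by omega
    have h3 := Nat.mul_le_mul_left (Q' + 1) h2
    have e : n + (k + 1) - 1 = n + k := by omega
    rw [e] at h1
    simp only [Nat.add_sub_cancel] at h1
    nlinarith
  rw [hsplit]
  refine Ideal.mul_mem_left _ _ (Ideal.subset_span ⟨_, ?_, rfl⟩)
  exact Ideal.pow_le_pow_right hn (monomial_mem_pow x _)

theorem reduction_pow {a q : Ideal R} {N : ℕ} (h : a ^ (N + 1) = q * a ^ N) (k : ℕ) :
    a ^ (N + k) = q ^ k * a ^ N := by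
  induction k with
  | zero => simp
  | succ k ih =>
    rw [← add_assoc, pow_succ, ih, mul_assoc, ← pow_succ, h, ← mul_assoc, ← pow_succ]

theorem reduction_pow_le {a q : Ideal R} {N : ℕ} (h : a ^ (N + 1) = q * a ^ N) (k : ℕ) :
    a ^ (N + k) ≤ q ^ k := by
  rw [reduction_pow h]
  exact Ideal.mul_le_left

theorem exists_Rcirc_mem_pow [IsNoetherianRing R] (a : Ideal R)
    (hht : ∀ P ∈ minimalPrimes R, ¬ a ≤ P) (N : ℕ) : ∃ c ∈ Rcirc R, c ∈ a ^ N := by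
  by_contra hcon
  have hsub : ((a ^ N : Ideal R) : Set R) ⊆ ⋃ P ∈ minimalPrimes R, ((id P : Ideal R) : Set R) := by
    intro c hc
    by_contra hc'
    refine hcon ⟨c, fun P hP hcP => hc' ?_, hc⟩
    simp only [Set.mem_iUnion]
    exact ⟨P, hP, hcP⟩
  obtain ⟨P, hP, hle⟩ := (Ideal.subset_union_prime_finite
    (minimalPrimes.finite_of_isNoetherianRing R) (f := id) 0 0
    (fun P hP _ _ => hP.1.1)).1 hsub
  haveI : P.IsPrime := hP.1.1
  exact hht P hP (Ideal.IsPrime.le_of_pow_le hle)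

end Helpers

/-- **Corollary 4.3 (modified Briançon–Skoda)** (Hara–Takagi).  `(R,m)` a complete Noetherian
reduced local ring of characteristic `p > 0`, `a` an ideal of positive height with a reduction
generated by `l` elements.  Then `τ(a^{n+l-1}) ⊆ aⁿ` for all `n ≥ 0`. -/
theorem modified_briancon_skoda
    (p : ℕ) [Fact p.Prime] [CharP R p]
    [IsNoetherianRing R] [IsReduced R] [IsLocalRing R]
    [IsAdicComplete (IsLocalRing.maximalIdeal R) R]
    (a : Ideal R) (hht : ∀ P ∈ minimalPrimes R, ¬ a ≤ P)
    (l : ℕ)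
    (hred : ∃ q : Ideal R, q ≤ a ∧ (∃ x : Fin l → R, Ideal.span (Set.range x) = q) ∧
      ∃ n : ℕ, a ^ (n + 1) = q * a ^ n) :
    ∀ n : ℕ, testIdeal R p a (((n + l - 1 : ℕ) : ℚ)) ≤ a ^ n := by
  obtain ⟨q, hqa, ⟨x, rfl⟩, N, hN⟩ := hred
  intro n
  rcases Nat.eq_zero_or_pos l with rfl | hl
  · exfalso
    obtain ⟨P, hP, -⟩ := Ideal.exists_minimalPrimes_le
      (I := (⊥ : Ideal R)) (J := IsLocalRing.maximalIdeal R) bot_le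
    haveI : P.IsPrime := hP.1.1
    refine hht P hP (Ideal.IsPrime.le_of_pow_le (n := N + 1) ?_)
    rw [hN]
    simp
  have hone : (1 : R) ∈ tightClosure R p a (((n + l - 1 : ℕ) : ℚ)) (a ^ n) := by
    obtain ⟨c, hc, hcN⟩ := exists_Rcirc_mem_pow a hht N
    refine ⟨c, hc, 0, fun e _ y hy => ?_⟩
    have hceil : ⌈((n + l - 1 : ℕ) : ℚ) * (p : ℚ) ^ e⌉₊ = (n + l - 1) * p ^ e := by
      rw [← Nat.cast_pow, ← Nat.cast_mul, Nat.ceil_natCast]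
    rw [hceil] at hy
    have h1 : c * y ∈ a ^ (N + (n + l - 1) * p ^ e) := by
      rw [pow_add]
      exact Ideal.mul_mem_mul hcN hy
    have h3 : c * y ∈ Ideal.span (Set.range x) ^ ((n + l - 1) * p ^ e) :=
      reduction_pow_le hN _ h1
    have h2 := span_pow_le_frobPow hl x n (p ^ e) (pow_pos (Fact.out : p.Prime).pos e) h3
    rw [one_pow, mul_one]
    have hle : Ideal.span (Set.range x) ^ n ≤ a ^ n := Ideal.pow_right_mono hqa n
    have hle2 : frobPow R (Ideal.span (Set.range x) ^ n) (p ^ e) ≤ frobPow R (a ^ n) (p ^ e) := by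
      unfold frobPow
      exact Ideal.span_mono (Set.image_mono hle)
    exact hle2 h2
  intro r hr
  have h := (Submodule.mem_iInf _).1 hr (a ^ n)
  simpa using Submodule.mem_colon.1 h 1 (Ideal.subset_span hone)
end

section
/- Let (R,m) be a complete Noetherian reduced local ring of prime characteristic p > 0 which is weakly F-regular, and let a ⊆ R be an ideal of positive height possessing a reduction generated by l elements. Then the integral closure of a^{n+l-1} is contained in a^n for all integers n ≥ 0. -/
open scoped TensorProduct

universe u

variable (R : Type u) [CommRing R]

/-- The classical tight closure `J*` of an ideal `J`. -/
def classicalTightClosure (p : ℕ) (J : Ideal R) : Set R :=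
  {z : R | ∃ c ∈ Rcirc R, ∃ e₀ : ℕ, ∀ e : ℕ, e₀ ≤ e → c * z ^ p ^ e ∈ frobPow R J (p ^ e)}

/-- `R` is weakly F-regular: every ideal is tightly closed. -/
def WeaklyFRegular (p : ℕ) : Prop :=
  ∀ J : Ideal R, classicalTightClosure R p J ⊆ (J : Set R)

/-- The integral closure of an ideal `I`: elements satisfying an equation
`x^k + c_1 x^{k-1} + ⋯ + c_k = 0` with `c_j ∈ I^j`. -/
def idealIntegralClosure (I : Ideal R) : Set R :=
  {x : R | ∃ k : ℕ, 0 < k ∧ ∃ c : ℕ → R, (∀ j : ℕ, 1 ≤ j → j ≤ k → c j ∈ I ^ j) ∧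
    x ^ k + ∑ j ∈ Finset.Icc 1 k, c j * x ^ (k - j) = 0}

lemma bs_pow_le_monomials {l : ℕ} (x : Fin l → R) (M : ℕ) :
    (Ideal.span (Set.range x)) ^ M ≤
      Ideal.span {y : R | ∃ α : Fin l → ℕ, ∑ i, α i = M ∧ y = ∏ i, x i ^ α i} := by
  induction M with
  | zero =>
    rw [pow_zero, Ideal.one_eq_top, top_le_iff, Ideal.eq_top_iff_one]
    exact Ideal.subset_span ⟨fun _ => 0, by simp, by simp⟩
  | succ M ih =>
    rw [pow_succ]
    refine (Ideal.mul_mono_left ih).trans ?_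
    rw [Ideal.span_mul_span', Ideal.span_le]
    rintro _ ⟨_, ⟨α, hα, rfl⟩, _, ⟨j, rfl⟩, rfl⟩
    refine Ideal.subset_span ⟨fun i => α i + if i = j then 1 else 0, ?_, ?_⟩
    · simp [Finset.sum_add_distrib, hα]
    · simp only [pow_add, Finset.prod_mul_distrib, pow_ite, pow_one, pow_zero]
      simp

lemma bs_pow_le_frobPow {l : ℕ} (x : Fin l → R) (n Q : ℕ) (hQ : 0 < Q) (hn : 0 < n) (hl : 0 < l) :
    (Ideal.span (Set.range x)) ^ ((n + l - 1) * Q) ≤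
      frobPow R ((Ideal.span (Set.range x)) ^ n) Q := by
  refine (bs_pow_le_monomials R x _).trans ?_
  rw [Ideal.span_le]
  rintro _ ⟨α, hα, rfl⟩
  have h1 : ∏ i, x i ^ α i = (∏ i, x i ^ (α i % Q)) * (∏ i, x i ^ (α i / Q)) ^ Q := by
    rw [← Finset.prod_pow, ← Finset.prod_mul_distrib]
    refine Finset.prod_congr rfl fun i _ => ?_
    rw [← pow_mul, ← pow_add, mul_comm, Nat.mod_add_div]
  rw [h1]
  refine Ideal.mul_mem_left _ _ (Ideal.subset_span ⟨_, ?_, rfl⟩)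
  have h2 : n ≤ ∑ i, α i / Q := by
    have h3 : ∑ i, α i < ∑ i : Fin l, (α i / Q + 1) * Q := by
      refine Finset.sum_lt_sum_of_nonempty ⟨⟨0, hl⟩, Finset.mem_univ _⟩ fun i _ => ?_
      rw [mul_comm]
      exact Nat.lt_mul_div_succ _ hQ
    rw [hα, ← Finset.sum_mul, Finset.sum_add_distrib] at h3
    have := lt_of_mul_lt_mul_right h3 (Nat.zero_le _)
    simp at this
    omega
  refine Ideal.pow_le_pow_right h2 ?_
  rw [← Finset.prod_pow_eq_pow_sum]
  exact Ideal.prod_mem_prod fun i _ =>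
    Ideal.pow_mem_pow (Ideal.subset_span (Set.mem_range_self i)) _

lemma bs_integral_pow {b : Ideal R} {z : R} (hz : z ∈ idealIntegralClosure R b) :
    ∃ k : ℕ, ∀ d ∈ b ^ k, ∀ i, d * z ^ i ∈ b ^ i := by
  obtain ⟨k, hk, c, hc, heq⟩ := hz
  obtain ⟨k, rfl⟩ : ∃ k', k = k' + 1 := ⟨k - 1, by omega⟩
  have key : ∀ i, z ^ (i + k) ∈ b ^ i := by
    intro i
    induction i using Nat.strong_induction_on with
    | _ i ih =>
      rcases i with _ | i
      · simp
      have e : z ^ (i + 1 + k) =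
          -∑ j ∈ Finset.Icc 1 (k + 1), z ^ i * (c j * z ^ (k + 1 - j)) := by
        rw [← Finset.mul_sum]
        linear_combination z ^ i * heq
      rw [e]
      refine neg_mem (sum_mem fun j hj => ?_)
      rw [Finset.mem_Icc] at hj
      have hcj := hc j hj.1 hj.2
      by_cases hji : j ≤ i + 1
      · have h1 := ih (i + 1 - j) (by omega)
        have h2 := Ideal.mul_mem_mul hcj h1
        rw [← pow_add, show j + (i + 1 - j) = i + 1 by omega] at h2
        have h3 : z ^ i * (c j * z ^ (k + 1 - j)) = c j * z ^ (i + 1 - j + k) := by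
          rw [mul_left_comm, ← pow_add]
          congr 2
          omega
        rwa [h3]
      · refine Ideal.mul_mem_left _ _ (Ideal.mul_mem_right _ _ ?_)
        exact Ideal.pow_le_pow_right (by omega) hcj
  refine ⟨k, fun d hd i => ?_⟩
  by_cases hik : i ≤ k
  · exact Ideal.mul_mem_right _ _ (Ideal.pow_le_pow_right hik hd)
  · have h2 := Ideal.mul_mem_mul hd (key (i - k))
    rwa [← pow_add, show k + (i - k) = i by omega, show i - k + k = i by omega] at h2

lemma bs_exists_mem [IsNoetherianRing R] (a : Ideal R) (hht : ∀ P ∈ minimalPrimes R, ¬ a ≤ P) :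
    ∃ c ∈ a, c ∈ Rcirc R := by
  have hfin : (minimalPrimes R).Finite := minimalPrimes.finite_of_isNoetherianRing R
  by_contra hcon
  push Not at hcon
  have hsub : (a : Set R) ⊆ ⋃ P ∈ (hfin.toFinset : Set (Ideal R)), (P : Set R) := by
    intro c hc
    have := hcon c hc
    simp only [Rcirc, Set.mem_ofPred_eq, not_forall, not_not] at this
    obtain ⟨P, hP, hcP⟩ := this
    simp only [Set.mem_iUnion]
    exact ⟨P, by simpa using hP, hcP⟩
  obtain ⟨P, hP, h⟩ := (Ideal.subset_union_prime (f := fun P : Ideal R => P) ⊥ ⊥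
    (fun P hP _ _ => ((hfin.mem_toFinset.1 hP).1.1))).1 hsub
  exact hht P (hfin.mem_toFinset.1 hP) h

/-- **Corollary 4.3, second assertion** (Hara–Takagi).  If `(R,m)` is a complete Noetherian
reduced weakly F-regular local ring of characteristic `p > 0` and `a` is an ideal of positive
height with a reduction generated by `l` elements, then the integral closure of `a^{n+l-1}`
is contained in `aⁿ` for all `n ≥ 0`. -/
theorem briancon_skoda_weakly_F_regular
    (p : ℕ) [Fact p.Prime] [CharP R p]
    [IsNoetherianRing R] [IsReduced R] [IsLocalRing R]
    [IsAdicComplete (IsLocalRing.maximalIdeal R) R]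
    (hwfr : WeaklyFRegular R p)
    (a : Ideal R) (hht : ∀ P ∈ minimalPrimes R, ¬ a ≤ P)
    (l : ℕ)
    (hred : ∃ q : Ideal R, q ≤ a ∧ (∃ x : Fin l → R, Ideal.span (Set.range x) = q) ∧
      ∃ n : ℕ, a ^ (n + 1) = q * a ^ n) :
    ∀ n : ℕ, idealIntegralClosure R (a ^ (n + l - 1)) ⊆ ((a ^ n : Ideal R) : Set R) := by
  obtain ⟨q, hqa, ⟨x, rfl⟩, m, hm⟩ := hred
  intro n z hz
  rcases Nat.eq_zero_or_pos n with rfl | hn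
  · simp
  have hpow : ∀ j, a ^ (m + j) ≤ Ideal.span (Set.range x) ^ j := by
    intro j
    have : a ^ (m + j) = Ideal.span (Set.range x) ^ j * a ^ m := by
      induction j with
      | zero => simp
      | succ j ih =>
        rw [← add_assoc, pow_succ, ih, mul_assoc, ← pow_succ, hm, ← mul_assoc, ← pow_succ]
    rw [this]
    exact Ideal.mul_le_left (I := Ideal.span (Set.range x) ^ j) (J := a ^ m)
  have hl : 0 < l := by
    rcases Nat.eq_zero_or_pos l with rfl | h
    · exfalso
      obtain ⟨P, hP⟩ := Ideal.nonempty_minimalPrimes (I := (⊥ : Ideal R)) bot_ne_top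
      have hprime : P.IsPrime := hP.1.1
      refine hht P hP (hprime.le_of_pow_le (n := m + 1) ((hpow 1).trans ?_))
      simp
    · exact h
  obtain ⟨k, hk⟩ := bs_integral_pow R hz
  obtain ⟨c₀, hc₀a, hc₀⟩ := bs_exists_mem R a hht
  refine Ideal.pow_right_mono hqa n (hwfr _ ⟨c₀ ^ m * c₀ ^ ((n + l - 1) * k), ?_, 0, ?_⟩)
  · intro P hP h
    have hprime : P.IsPrime := hP.1.1
    rw [← pow_add] at h
    exact hc₀ P hP (hprime.mem_of_pow_mem _ h)
  · intro e _
    apply bs_pow_le_frobPow R x n (p ^ e) (pow_pos (Fact.out : p.Prime).pos e) hn hl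
    apply hpow
    rw [pow_add, mul_assoc]
    refine Ideal.mul_mem_mul (Ideal.pow_mem_pow hc₀a m) ?_
    rw [pow_mul a]
    refine hk _ ?_ _
    rw [← pow_mul]
    exact Ideal.pow_mem_pow hc₀a _
end

section
/- Let (R,m) be a complete Noetherian reduced local ring of prime characteristic p > 0 of dimension d with infinite residue field R/m, let a ⊆ R be an ideal of positive height, let b be an ideal of R with b ∩ R° ≠ ∅, and let t ≥ 0 be a rational number. Then for every integer n ≥ 0, τ(a^{n+d-1}·b^t) = τ(a^{d-1}·b^t)·a^n. -/
open scoped TensorProduct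

universe u

variable (R : Type u) [CommRing R]

section SkodaAux
variable {A : Type u} [CommRing A]

/-- `I` is irreducible with socle representative `w`. -/
def SkIrrAt (I : Ideal A) (w : A) : Prop := w ∉ I ∧ ∀ x ∉ I, ∃ r, w - r * x ∈ I

theorem sk_exists_irr [IsNoetherianRing A] (J : Ideal A) (w : A) (hw : w ∉ J) :
    ∃ I, J ≤ I ∧ SkIrrAt I w := by
  obtain ⟨I, ⟨hJI, hwI⟩, hmax⟩ := set_has_maximal_iff_noetherian.mpr
    (inferInstanceAs (IsNoetherian A A)) {I : Ideal A | J ≤ I ∧ w ∉ I} ⟨J, le_rfl, hw⟩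
  refine ⟨I, hJI, hwI, fun x hx => ?_⟩
  by_contra hcon
  push Not at hcon
  refine hmax (I ⊔ Ideal.span {x}) ⟨hJI.trans le_sup_left, fun h => ?_⟩ ?_
  · obtain ⟨i, hi, y, hy, hiy⟩ := Submodule.mem_sup.mp h
    obtain ⟨r, rfl⟩ := Ideal.mem_span_singleton'.mp hy
    exact hcon r (by rw [← hiy]; simpa using hi)
  · refine lt_of_le_of_ne le_sup_left fun h => hx ?_
    rw [h]
    exact Ideal.mem_sup_right (Ideal.mem_span_singleton_self x)

variable [IsLocalRing A]

local notation "𝔪" => IsLocalRing.maximalIdeal A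

theorem sk_unit_mul {I : Ideal A} {r x : A} (hr : r ∉ 𝔪) (h : r * x ∈ I) : x ∈ I := by
  have hu : IsUnit r := by simpa using hr
  exact (Ideal.unit_mul_mem_iff_mem I hu).mp h

theorem sk_socle {I : Ideal A} {w : A} (h : SkIrrAt I w) {y : A} (hy : y ∈ 𝔪) : y * w ∈ I := by
  by_contra hc
  obtain ⟨r, hr⟩ := h.2 _ hc
  have h1 : (1 - r * y) * w ∈ I := by convert hr using 1; ring
  refine h.1 (sk_unit_mul ?_ h1)
  intro h2
  have : (1 : A) ∈ 𝔪 := by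
    have := Ideal.add_mem _ h2 (Ideal.mul_mem_left _ r hy)
    rwa [sub_add_cancel] at this
  exact (Ideal.ne_top_iff_one _).mp (IsLocalRing.maximalIdeal.isMaximal A).ne_top this

theorem sk_socle_gen {I : Ideal A} {w : A} (h : SkIrrAt I w) {z : A}
    (hz : ∀ y ∈ 𝔪, y * z ∈ I) : ∃ c, z - c * w ∈ I := by
  by_cases hzI : z ∈ I
  · exact ⟨0, by simpa using hzI⟩
  obtain ⟨r, hr⟩ := h.2 z hzI
  have hr' : r ∉ 𝔪 := fun hrm => h.1 (by simpa using Ideal.add_mem _ hr (hz r hrm))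
  have hu : IsUnit r := by simpa using hr'
  obtain ⟨s, hs⟩ := hu.exists_left_inv
  refine ⟨s, ?_⟩
  have := I.mul_mem_left (-s) hr
  convert this using 1
  linear_combination - z * hs

variable [IsNoetherianRing A]

theorem sk_closed (I : Ideal A) (x : A) (h : ∀ n : ℕ, x ∈ I ⊔ 𝔪 ^ n) : x ∈ I := by
  by_cases hI : I = ⊤
  · simp [hI]
  have hb := Ideal.iInf_pow_smul_eq_bot_of_isLocalRing (R := A) (M := A ⧸ I) 𝔪
    (IsLocalRing.maximalIdeal.isMaximal A).ne_top
  rw [← Ideal.Quotient.eq_zero_iff_mem, ← Submodule.mem_bot A, ← hb, Submodule.mem_iInf]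
  intro n
  obtain ⟨i, hi, y, hy, rfl⟩ := Submodule.mem_sup.mp (h n)
  rw [map_add, Ideal.Quotient.eq_zero_iff_mem.mpr hi, zero_add]
  have : (Ideal.Quotient.mk I y) = y • (1 : A ⧸ I) := by
    rw [Algebra.smul_def, mul_one]; rfl
  rw [this]
  exact Submodule.smul_mem_smul hy trivial

theorem sk_primary {I : Ideal A} {w : A} (h : SkIrrAt I w) : ∃ N : ℕ, 𝔪 ^ N ≤ I := by
  by_contra hc
  push Not at hc
  refine h.1 (sk_closed I w fun n => ?_)
  obtain ⟨x, hx, hxI⟩ := SetLike.not_le_iff_exists.mp (hc n)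
  obtain ⟨r, hr⟩ := h.2 x hxI
  have := Submodule.add_mem_sup hr (Ideal.mul_mem_left (𝔪 ^ n) r hx)
  simpa using this

/-- separation property -/
theorem sk_sep {I : Ideal A} {w : A} (h : SkIrrAt I w) (K : Ideal A) (hIK : I ≤ K) :
    ∀ x ∉ K, ∃ y, (∀ k ∈ K, y * k ∈ I) ∧ y * x ∉ I := by
  obtain ⟨K₀, ⟨hIK₀, hK₀K, hP⟩, hmax⟩ := set_has_maximal_iff_noetherian.mpr
    (inferInstanceAs (IsNoetherian A A))
    {K' : Ideal A | I ≤ K' ∧ K' ≤ K ∧ ∀ x ∉ K', ∃ y, (∀ k ∈ K', y * k ∈ I) ∧ y * x ∉ I}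
    ⟨I, le_rfl, hIK, fun x hx => ⟨1, fun k hk => by simpa using hk, by simpa using hx⟩⟩
  have hP' : ∀ x ∉ K₀, ∃ y, (∀ k ∈ K₀, y * k ∈ I) ∧ y * x - w ∈ I := by
    intro x hx
    obtain ⟨y, hy, hyx⟩ := hP x hx
    obtain ⟨r, hr⟩ := h.2 _ hyx
    refine ⟨r * y, fun k hk => by rw [mul_assoc]; exact I.mul_mem_left _ (hy k hk), ?_⟩
    rw [← neg_mem_iff]; convert hr using 1; ring
  rcases eq_or_lt_of_le hK₀K with heq | hlt
  · rwa [← heq]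
  exfalso
  -- find v
  obtain ⟨v, hvK, hv, hmv⟩ : ∃ v ∈ K, v ∉ K₀ ∧ ∀ y ∈ 𝔪, y * v ∈ K₀ := by
    obtain ⟨v₀, hv₀K, hv₀⟩ := SetLike.exists_of_lt hlt
    obtain ⟨N, hN⟩ := sk_primary h
    have hex : ∃ j : ℕ, ∀ y ∈ 𝔪 ^ j, y * v₀ ∈ K₀ :=
      ⟨N, fun y hy => Ideal.mul_mem_right _ K₀ (hIK₀ (hN hy))⟩
    classical
    have hs := Nat.find_spec hex
    have hj0 : Nat.find hex ≠ 0 := by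
      intro h0
      rw [h0] at hs
      exact hv₀ (by simpa using hs 1 (by simp))
    obtain ⟨j, hj⟩ := Nat.exists_eq_succ_of_ne_zero hj0
    have hm := Nat.find_min hex (m := j) (by omega)
    push Not at hm
    obtain ⟨y, hy, hyv⟩ := hm
    refine ⟨y * v₀, K.mul_mem_left _ hv₀K, hyv, fun z hz => ?_⟩
    rw [← mul_assoc]
    apply hs
    rw [hj, Nat.succ_eq_add_one, pow_succ']
    exact Ideal.mul_mem_mul hz hy
  have hsoc : ∀ y, (∀ k ∈ K₀, y * k ∈ I) → ∃ c, y * v - c * w ∈ I := by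
    intro y hy
    refine sk_socle_gen h fun z hz => ?_
    have := hy _ (hmv z hz)
    convert this using 1; ring
  refine hmax (K₀ ⊔ Ideal.span {v}) ⟨hIK₀.trans le_sup_left, sup_le hK₀K ?_, ?_⟩ ?_
  · rw [Ideal.span_singleton_le_iff_mem]; exact hvK
  · intro x hx
    have hx0 : x ∉ K₀ := fun h' => hx (Ideal.mem_sup_left h')
    suffices hs : ∃ y, (∀ k ∈ K₀, y * k ∈ I) ∧ y * v ∈ I ∧ y * x ∉ I by
      obtain ⟨y, h1, h2, h3⟩ := hs
      refine ⟨y, fun k hk => ?_, h3⟩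
      obtain ⟨i, hi, z, hz, rfl⟩ := Submodule.mem_sup.mp hk
      obtain ⟨r, rfl⟩ := Ideal.mem_span_singleton'.mp hz
      rw [mul_add]
      refine I.add_mem (h1 i hi) ?_
      have := I.mul_mem_left r h2
      convert this using 1; ring
    obtain ⟨y₀, hy₀, hy₀x⟩ := hP' x hx0
    obtain ⟨c, hc⟩ := hsoc y₀ hy₀
    by_cases hcm : c ∈ 𝔪
    · refine ⟨y₀, hy₀, ?_, ?_⟩
      · have := I.add_mem hc (sk_socle h hcm)
        simpa using this
      · intro h'
        exact h.1 (by simpa using I.sub_mem h' hy₀x)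
    · have hu : IsUnit c := by simpa using hcm
      obtain ⟨s, hs⟩ := hu.exists_left_inv
      have hx' : v - c * x ∉ K₀ := by
        intro h'
        apply hx
        have h1 : v - s * (v - c * x) * c  = c * x + (1 - s * c) * (v - c * x) := by ring
        have : x = s * v - s * (v - c * x) := by linear_combination (-x) * hs
        rw [this]
        exact Ideal.sub_mem _ (Ideal.mul_mem_left _ _ (Ideal.mem_sup_right
          (Ideal.mem_span_singleton_self v))) (Ideal.mul_mem_left _ _ (Ideal.mem_sup_left h'))
      obtain ⟨y₁, hy₁, hy₁x⟩ := hP' _ hx'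
      obtain ⟨c₁, hc₁⟩ := hsoc y₁ hy₁
      refine ⟨y₁ - c₁ * s * y₀, fun k hk => ?_, ?_, ?_⟩
      · rw [sub_mul, mul_assoc]
        exact I.sub_mem (hy₁ k hk) (I.mul_mem_left _ (hy₀ k hk))
      · have := I.sub_mem hc₁ (I.mul_mem_left (c₁ * s) hc)
        convert this using 1
        linear_combination (-c₁ * w) * hs
      · intro h'
        apply h.1
        -- (y₁ - c₁ s y₀) v ∈ I
        have e1 := I.sub_mem hc₁ (I.mul_mem_left (c₁ * s) hc)
        have e2 := I.sub_mem hc (I.mul_mem_left c hy₀x)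
        -- y₀ (v - c x) ∈ I
        have e3 := I.mul_mem_left (c₁ * s) e2
        have e4 := I.mul_mem_left c h'
        have := I.sub_mem (I.sub_mem (I.sub_mem e1 e4) hy₁x) (I.neg_mem e3)
        convert this using 1
        linear_combination (-c₁ * w) * hs
  · refine lt_of_le_of_ne le_sup_left fun h' => hv ?_
    rw [h']
    exact Ideal.mem_sup_right (Ideal.mem_span_singleton_self v)

/-- double annihilator -/
theorem sk_double {I : Ideal A} {w : A} (h : SkIrrAt I w) (K : Ideal A) (hIK : I ≤ K) (x : A)
    (hx : ∀ y, (∀ k ∈ K, y * k ∈ I) → y * x ∈ I) : x ∈ K := by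
  by_contra hc
  obtain ⟨y, hy, hyx⟩ := sk_sep h K hIK x hc
  exact hyx (hx y hy)

theorem sk_embed {I I' : Ideal A} {w w' : A} (h : SkIrrAt I w) (h' : SkIrrAt I' w') (hle : I' ≤ I) :
    ∃ y, ∀ x, x ∈ I ↔ y * x ∈ I' := by
  obtain ⟨y, hy, hyw⟩ := sk_sep h' I hle w h.1
  refine ⟨y, fun x => ⟨hy x, fun hx => ?_⟩⟩
  by_contra hc
  obtain ⟨r, hr⟩ := h.2 x hc
  apply hyw
  have := I'.add_mem (hy _ hr) (I'.mul_mem_left r hx)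
  convert this using 1; ring

/-- gluing -/
theorem sk_glue {B I₁ I₂ : Ideal A} {w₁ w₂ f g : A} (h₁ : SkIrrAt I₁ w₁) (h₂ : SkIrrAt I₂ w₂)
    (hfg : ∀ r s, r * f + s * g ∈ B → r ∈ I₁ ∧ s ∈ I₂) :
    ∃ I w, SkIrrAt I w ∧ B ≤ I ∧ (∀ x, x * f ∈ I → x ∈ I₁) ∧ (∀ x, x * g ∈ I → x ∈ I₂) := by
  let C : Ideal A := B ⊔ (I₁ * Ideal.span {f} ⊔ (I₂ * Ideal.span {g} ⊔
    Ideal.span {f * w₁ - g * w₂}))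
  have hC : f * w₁ ∉ C := by
    intro hmem
    obtain ⟨b, hb, y, hy, e1⟩ := Submodule.mem_sup.mp hmem
    obtain ⟨i, hi, y, hy, e2⟩ := Submodule.mem_sup.mp hy
    obtain ⟨j, hj, y, hy, e3⟩ := Submodule.mem_sup.mp hy
    obtain ⟨x, e4⟩ := Ideal.mem_span_singleton'.mp hy
    obtain ⟨i, hi', rfl⟩ := Ideal.mem_mul_span_singleton.mp hi
    obtain ⟨j, hj', rfl⟩ := Ideal.mem_mul_span_singleton.mp hj
    have key : ((1 - x) * w₁ - i) * f + (x * w₂ - j) * g ∈ B := by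
      convert hb using 1
      linear_combination -(e1 + e2 + e3 + e4)
    obtain ⟨k1, k2⟩ := hfg _ _ key
    have l1 : (1 - x) * w₁ ∈ I₁ := by simpa using I₁.add_mem k1 hi'
    have l2 : x * w₂ ∈ I₂ := by simpa using I₂.add_mem k2 hj'
    have m1 : 1 - x ∈ 𝔪 := by by_contra hc; exact h₁.1 (sk_unit_mul hc l1)
    have m2 : x ∈ 𝔪 := by by_contra hc; exact h₂.1 (sk_unit_mul hc l2)
    have : (1 : A) ∈ 𝔪 := by simpa using Ideal.add_mem _ m1 m2
    exact (Ideal.ne_top_iff_one _).mp (IsLocalRing.maximalIdeal.isMaximal A).ne_top this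
  obtain ⟨I, hCI, hI⟩ := sk_exists_irr C _ hC
  have c1 : ∀ i ∈ I₁, i * f ∈ I := fun i hi => hCI (Ideal.mem_sup_right (Ideal.mem_sup_left
    (Ideal.mul_mem_mul hi (Ideal.mem_span_singleton_self f))))
  have c2 : ∀ i ∈ I₂, i * g ∈ I := fun i hi => hCI (Ideal.mem_sup_right (Ideal.mem_sup_right
    (Ideal.mem_sup_left (Ideal.mul_mem_mul hi (Ideal.mem_span_singleton_self g)))))
  have c3 : f * w₁ - g * w₂ ∈ I := hCI (Ideal.mem_sup_right (Ideal.mem_sup_right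
    (Ideal.mem_sup_right (Ideal.mem_span_singleton_self _))))
  refine ⟨I, _, hI, le_sup_left.trans hCI, fun x hx => ?_, fun x hx => ?_⟩
  · by_contra hc
    obtain ⟨r, hr⟩ := h₁.2 x hc
    apply hI.1
    have := I.add_mem (c1 _ hr) (I.mul_mem_left r hx)
    convert this using 1; ring
  · by_contra hc
    obtain ⟨r, hr⟩ := h₂.2 x hc
    apply hI.1
    have := I.add_mem c3 (I.add_mem (c2 _ hr) (I.mul_mem_left r hx))
    convert this using 1; ring

theorem sk_lift {B I₁ : Ideal A} {w₁ f : A} (h₁ : SkIrrAt I₁ w₁)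
    (hf : ∀ r, r * f ∈ B → r ∈ I₁) :
    ∃ I w, SkIrrAt I w ∧ B ≤ I ∧ (∀ x, x * f ∈ I ↔ x ∈ I₁) := by
  let C : Ideal A := B ⊔ I₁ * Ideal.span {f}
  have hC : f * w₁ ∉ C := by
    intro hmem
    obtain ⟨b, hb, y, hy, e1⟩ := Submodule.mem_sup.mp hmem
    obtain ⟨i, hi, rfl⟩ := Ideal.mem_mul_span_singleton.mp hy
    have key : (w₁ - i) * f ∈ B := by
      convert hb using 1
      linear_combination -e1
    exact h₁.1 (by simpa using I₁.add_mem (hf _ key) hi)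
  obtain ⟨I, hCI, hI⟩ := sk_exists_irr C _ hC
  have c1 : ∀ i ∈ I₁, i * f ∈ I := fun i hi => hCI (Ideal.mem_sup_right
    (Ideal.mul_mem_mul hi (Ideal.mem_span_singleton_self f)))
  refine ⟨I, _, hI, le_sup_left.trans hCI, fun x => ⟨fun hx => ?_, c1 x⟩⟩
  by_contra hc
  obtain ⟨r, hr⟩ := h₁.2 x hc
  apply hI.1
  have := I.add_mem (c1 _ hr) (I.mul_mem_left r hx)
  convert this using 1; ring
end SkodaAux

section SkodaAux2
variable {A : Type u} [CommRing A] [IsLocalRing A] [IsNoetherianRing A]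

local notation "𝔪" => IsLocalRing.maximalIdeal A

theorem sk_least (F : Set (Ideal A)) (hne : F.Nonempty)
    (hdir : ∀ B ∈ F, ∀ C ∈ F, ∃ D ∈ F, D ≤ B ∧ D ≤ C) (n : ℕ) :
    ∃ B ∈ F, ∀ C ∈ F, B ≤ C ⊔ 𝔪 ^ n := by
  rcases Nat.eq_zero_or_pos n with rfl | hn
  · obtain ⟨B, hB⟩ := hne
    exact ⟨B, hB, fun C _ => by simp⟩
  have hmem : 𝔪 ∈ (𝔪 ^ n).minimalPrimes := by
    refine ⟨⟨inferInstance, Ideal.pow_le_self hn.ne'⟩, fun q hq hqm => ?_⟩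
    have := hq.1
    exact Ideal.IsPrime.le_of_pow_le hq.2
  have hart : IsArtinianRing (A ⧸ 𝔪 ^ n) :=
    IsLocalRing.quotient_artinian_of_mem_minimalPrimes_of_isLocalRing (𝔪 ^ n) hmem
  obtain ⟨M, ⟨B, hB, rfl⟩, hmin⟩ := IsArtinian.set_has_minimal
    ((fun B : Ideal A => B.map (Ideal.Quotient.mk (𝔪 ^ n))) '' F) (hne.image _)
  refine ⟨B, hB, fun C hC => ?_⟩
  obtain ⟨D, hD, hDB, hDC⟩ := hdir B hB C hC
  have h1 : D.map (Ideal.Quotient.mk (𝔪 ^ n)) = B.map (Ideal.Quotient.mk (𝔪 ^ n)) := by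
    by_contra hc
    exact hmin _ ⟨D, hD, rfl⟩ (lt_of_le_of_ne (Ideal.map_mono hDB) hc)
  have h2 : B.map (Ideal.Quotient.mk (𝔪 ^ n)) ≤ C.map (Ideal.Quotient.mk (𝔪 ^ n)) := by
    rw [← h1]; exact Ideal.map_mono hDC
  rw [Ideal.map_le_iff_le_comap, Ideal.comap_map_of_surjective _ Ideal.Quotient.mk_surjective,
    ← RingHom.ker_eq_comap_bot, Ideal.mk_ker] at h2
  exact h2

theorem sk_chevalley [IsAdicComplete 𝔪 A] (F : Set (Ideal A)) (hne : F.Nonempty)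
    (hdir : ∀ B ∈ F, ∀ C ∈ F, ∃ D ∈ F, D ≤ B ∧ D ≤ C) (N : ℕ) :
    ∃ B ∈ F, B ≤ sInf F ⊔ 𝔪 ^ N := by
  choose B hBF hB using sk_least F hne hdir
  refine ⟨B N, hBF N, fun x hx => ?_⟩
  have hstep : ∀ k : ℕ, ∀ y : B (N + k), ∃ z : B (N + (k + 1)), (z : A) - y ∈ 𝔪 ^ (N + k) := by
    intro k y
    obtain ⟨z, hz, t, ht, hzt⟩ := Submodule.mem_sup.mp (hB (N + k) _ (hBF (N + (k + 1))) y.2)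
    refine ⟨⟨z, hz⟩, ?_⟩
    rw [← hzt]
    simpa using ht
  choose nxt hnxt using hstep
  let s : ∀ k : ℕ, B (N + k) := fun k => Nat.rec (motive := fun k => B (N + k)) ⟨x, hx⟩ nxt k
  have hs : ∀ k, (s (k + 1) : A) - s k ∈ 𝔪 ^ (N + k) := fun k => hnxt k (s k)
  have hs' : ∀ k j, (s (k + j) : A) - s k ∈ 𝔪 ^ (N + k) := by
    intro k j
    induction j with
    | zero => simp
    | succ j ih =>
      have := Ideal.add_mem _ (Ideal.pow_le_pow_right (by omega : N + k ≤ N + (k + j)) (hs (k + j))) ih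
      rw [sub_add_sub_cancel] at this
      exact this
  obtain ⟨l, hl⟩ := IsPrecomplete.prec (I := 𝔪) (M := A) inferInstance
    (f := fun k => (s k : A)) (by
      intro m n hmn
      obtain ⟨j, rfl⟩ := Nat.exists_eq_add_of_le hmn
      rw [SModEq.sub_mem, ← neg_mem_iff, neg_sub]
      simpa using Ideal.pow_le_pow_right (by omega) (hs' m j))
  have hl' : ∀ k, l - (s k : A) ∈ 𝔪 ^ (N + k) := by
    intro k
    have h1 := hl (N + k)
    rw [SModEq.sub_mem, ← neg_mem_iff, neg_sub] at h1
    have h1' : l - (s (N + k) : A) ∈ 𝔪 ^ (N + k) := by simpa using h1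
    have h2 := hs' k N
    rw [add_comm k N] at h2
    have := Ideal.add_mem _ h1' h2
    rwa [sub_add_sub_cancel] at this
  have hlI : l ∈ sInf F := by
    rw [Submodule.mem_sInf]
    intro C hC
    refine sk_closed C l fun n => ?_
    have h1 := hB (N + n) C hC (s n).2
    have h2 := Ideal.add_mem _ (Ideal.mem_sup_right (S := C) (hl' n)) h1
    rw [sub_add_cancel] at h2
    exact sup_le_sup_left (Ideal.pow_le_pow_right (by omega)) C h2
  have h0 := hl' 0
  have : x = l - (l - x) := by ring
  rw [this]
  exact Ideal.sub_mem _ (Ideal.mem_sup_left hlI) (Ideal.mem_sup_right h0)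

/-- primes which are of coheight one -/
def SkP (P : Ideal A) : Prop :=
  P.IsPrime ∧ ∃ h ∈ 𝔪, h ∉ P ∧ ∀ J : Ideal A, P < J → ∃ n : ℕ, h ^ n ∈ J

theorem sk_seq [IsAdicComplete 𝔪 A] {P : Ideal A} (hP : SkP P) (N : ℕ) :
    ∃ I w, SkIrrAt I w ∧ P ≤ I ∧ I ≤ P ⊔ 𝔪 ^ N := by
  obtain ⟨hPp, h, hm, hhP, hmax⟩ := hP
  have h0 : ∃ I : Ideal A, (∃ w, SkIrrAt I w) ∧ P ≤ I := by
    obtain ⟨I, h1, h2⟩ := sk_exists_irr P 1 ((Ideal.ne_top_iff_one P).mp hPp.ne_top)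
    exact ⟨I, ⟨_, h2⟩, h1⟩
  have hstep : ∀ I : {I : Ideal A // (∃ w, SkIrrAt I w) ∧ P ≤ I},
      ∃ I' : {I : Ideal A // (∃ w, SkIrrAt I w) ∧ P ≤ I}, ∀ x, x * h ∈ I'.1 ↔ x ∈ I.1 := by
    rintro ⟨I, ⟨w, hw⟩, hPI⟩
    obtain ⟨I', w', h1, h2, h3⟩ := sk_lift (B := P) (f := h) hw
      (fun r hr => hPI ((hPp.mem_or_mem hr).resolve_right hhP))
    exact ⟨⟨I', ⟨w', h1⟩, h2⟩, h3⟩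
  choose nxt hnxt using hstep
  let s : ℕ → {I : Ideal A // (∃ w, SkIrrAt I w) ∧ P ≤ I} :=
    fun k => Nat.rec ⟨h0.choose, h0.choose_spec⟩ (fun _ => nxt) k
  have hs : ∀ k x, x * h ∈ (s (k + 1)).1 ↔ x ∈ (s k).1 := fun k => hnxt (s k)
  have hanti : Antitone fun k => (s k).1 := antitone_nat_of_succ_le fun k x hx =>
    (hs k x).mp (Ideal.mul_mem_right _ _ hx)
  have hnot : ∀ k, h ^ k ∉ (s k).1 := by
    intro k
    induction k with
    | zero =>
      obtain ⟨w, hw⟩ := (s 0).2.1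
      rw [pow_zero]
      intro h1
      exact hw.1 (by simpa using Ideal.mul_mem_left _ w h1)
    | succ k ih => rw [pow_succ, hs]; exact ih
  obtain ⟨B, ⟨k, rfl⟩, hk⟩ := sk_chevalley (Set.range fun k => (s k).1) ⟨_, ⟨0, rfl⟩⟩ (by
    rintro _ ⟨i, rfl⟩ _ ⟨j, rfl⟩
    exact ⟨_, ⟨max i j, rfl⟩, hanti (le_max_left _ _), hanti (le_max_right _ _)⟩) N
  obtain ⟨w, hw⟩ := (s k).2.1
  refine ⟨(s k).1, w, hw, (s k).2.2, hk.trans (sup_le_sup_right ?_ _)⟩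
  intro r hr
  by_contra hrP
  obtain ⟨n, hn⟩ := hmax (P ⊔ Ideal.span {r}) (lt_of_le_of_ne le_sup_left fun he => hrP (by
    rw [he]; exact Ideal.mem_sup_right (Ideal.mem_span_singleton_self r)))
  refine hnot n ?_
  refine (sup_le (s n).2.2 ?_ : P ⊔ Ideal.span {r} ≤ (s n).1) hn
  rw [Ideal.span_singleton_le_iff_mem]
  exact (Submodule.mem_sInf.mp hr) _ ⟨n, rfl⟩

theorem sk_multi [IsAdicComplete 𝔪 A] (N : ℕ) (S : Finset (Ideal A)) (hne : S.Nonempty)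
    (hS : ∀ P ∈ S, SkP P) (hanti : ∀ P ∈ S, ∀ Q ∈ S, P ≤ Q → P = Q) :
    ∃ I w, SkIrrAt I w ∧ S.inf id ≤ I ∧ ∀ P ∈ S, I ≤ P ⊔ 𝔪 ^ N := by
  classical
  induction hne using Finset.Nonempty.cons_induction with
  | singleton P =>
    obtain ⟨I, w, h1, h2, h3⟩ := sk_seq (hS P (by simp)) N
    exact ⟨I, w, h1, by simpa using h2, by simpa using h3⟩
  | cons P S hPS hSne ih =>
    obtain ⟨I₂, w₂, i1, i2, i3⟩ := ih (fun Q hQ => hS Q (by simp [hQ]))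
      (fun Q hQ Q' hQ' => hanti Q (by simp [hQ]) Q' (by simp [hQ']))
    have hP := hS P (by simp)
    have hPp := hP.1
    obtain ⟨I₁, w₁, j1, j2, j3⟩ := sk_seq hP N
    obtain ⟨f, hf, hfP⟩ : ∃ f ∈ S.inf id, f ∉ P := by
      rw [← SetLike.not_le_iff_exists]
      intro hle
      obtain ⟨Q, hQ, hQP⟩ := (Ideal.IsPrime.inf_le' hPp).mp hle
      have := hanti Q (by simp [hQ]) P (by simp) hQP
      exact hPS (this ▸ hQ)
    obtain ⟨g, hg, hgS⟩ : ∃ g ∈ P, ∀ Q ∈ S, g ∉ Q := by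
      by_contra hc
      push Not at hc
      have hsub : (P : Set A) ⊆ ⋃ Q ∈ (S : Set (Ideal A)), (Q : Set A) := by
        intro x hx
        obtain ⟨Q, hQ, hxQ⟩ := hc x hx
        simp only [Set.mem_iUnion]
        exact ⟨Q, hQ, hxQ⟩
      obtain ⟨Q, hQ, hle⟩ := (Ideal.subset_union_prime (f := id) (s := S) ⊤ ⊤
        (fun Q hQ _ _ => (hS Q (by simp [hQ])).1)).mp hsub
      have := hanti P (by simp) Q (by simp [hQ]) hle
      exact hPS (this ▸ hQ)
    obtain ⟨I, w, k1, k2, k3, k4⟩ := sk_glue (B := P ⊓ S.inf id) (f := f) (g := g) j1 i1 (by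
      intro r s hrs
      constructor
      · apply j2
        have : r * f ∈ P := by
          have := P.sub_mem hrs.1 (P.mul_mem_left s hg)
          simpa using this
        exact (hPp.mem_or_mem this).resolve_right hfP
      · apply i2
        have h1 : s * g ∈ S.inf id := by
          have := Ideal.sub_mem _ hrs.2 (Ideal.mul_mem_left _ r hf)
          simpa using this
        rw [Submodule.mem_finsetInf] at h1 ⊢
        intro Q hQ
        exact (((hS Q (by simp [hQ])).1).mem_or_mem (h1 Q hQ)).resolve_right (hgS Q hQ))
    refine ⟨I, w, k1, by simpa using k2, ?_⟩
    intro Q hQ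
    rcases Finset.mem_cons.mp hQ with rfl | hQ
    · exact le_trans (fun x hx => k3 x (Ideal.mul_mem_right _ _ hx)) j3
    · exact le_trans (fun x hx => k4 x (Ideal.mul_mem_right _ _ hx)) (i3 Q hQ)

theorem sk_exists_P [IsReduced A] (r : A) (hr : r ∈ 𝔪) (h0 : r ≠ 0) :
    ∃ P : Ideal A, SkP P ∧ r ∉ P := by
  obtain ⟨P, hP, hmax⟩ := set_has_maximal_iff_noetherian.mpr
    (inferInstanceAs (IsNoetherian A A))
    {P : Ideal A | Disjoint (P : Set A) (Submonoid.powers r : Set A)} ⟨⊥, by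
      simp only [Set.mem_ofPred_eq]
      rw [Set.disjoint_left]
      rintro x hx ⟨n, rfl⟩
      exact h0 (eq_zero_of_pow_eq_zero (by simpa using hx))⟩
  have hrP : r ∉ P := fun h => Set.disjoint_left.mp hP h ⟨1, by simp⟩
  refine ⟨P, ⟨?_, r, hr, hrP, ?_⟩, hrP⟩
  · exact Ideal.isPrime_of_maximally_disjoint P (Submonoid.powers r) hP
      (fun J hJ hd => hmax J hd hJ)
  · intro J hJ
    by_contra hc
    push Not at hc
    refine hmax J ?_ hJ
    simp only [Set.mem_ofPred_eq]
    rw [Set.disjoint_left]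
    rintro x hx ⟨n, rfl⟩
    exact hc n hx

/-- complete reduced local rings are approximately Gorenstein -/
theorem sk_approx [IsReduced A] [IsAdicComplete 𝔪 A] (N : ℕ) :
    ∃ I w, SkIrrAt I w ∧ I ≤ 𝔪 ^ N := by
  classical
  by_cases hm : 𝔪 = ⊥
  · refine ⟨⊥, 1, ⟨by simp, fun x hx => ?_⟩, bot_le⟩
    have hu : IsUnit x := by
      by_contra hc
      have : x ∈ 𝔪 := by simpa using hc
      rw [hm] at this
      exact hx this
    obtain ⟨s, hs⟩ := hu.exists_left_inv
    exact ⟨s, by simp [hs]⟩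
  obtain ⟨r₀, hr₀, hr₀0⟩ := Submodule.exists_mem_ne_zero_of_ne_bot hm
  obtain ⟨P₀, hP₀, -⟩ := sk_exists_P r₀ hr₀ hr₀0
  let F : Set (Ideal A) := {B | ∃ (S : Finset (Ideal A)) (k : ℕ), (∀ P ∈ S, SkP P) ∧ S.Nonempty ∧
    B = S.inf (fun P => P ⊔ 𝔪 ^ k)}
  obtain ⟨B, ⟨S, k, hS, hSne, rfl⟩, hB⟩ := sk_chevalley F
    ⟨_, {P₀}, 0, by simpa using hP₀, by simp, rfl⟩ (by
      rintro _ ⟨S, k, hS, hSn, rfl⟩ _ ⟨S', k', hS', hSn', rfl⟩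
      refine ⟨_, ⟨S ∪ S', max k k', ?_, hSn.mono Finset.subset_union_left, rfl⟩, ?_, ?_⟩
      · intro P hP
        rcases Finset.mem_union.mp hP with h | h
        exacts [hS P h, hS' P h]
      · refine Finset.le_inf fun P hP => (Finset.inf_le (Finset.mem_union_left _ hP)).trans ?_
        exact sup_le_sup_left (Ideal.pow_le_pow_right (le_max_left _ _)) _
      · refine Finset.le_inf fun P hP => (Finset.inf_le (Finset.mem_union_right _ hP)).trans ?_
        exact sup_le_sup_left (Ideal.pow_le_pow_right (le_max_right _ _)) _) N
  have hF : sInf F = ⊥ := by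
    rw [eq_bot_iff]
    intro r hr
    rw [Submodule.mem_sInf] at hr
    have hrP : ∀ P, SkP P → r ∈ P := by
      intro P hP
      refine sk_closed P r fun n => ?_
      have := hr _ ⟨{P}, n, by simpa using hP, by simp, rfl⟩
      simpa using this
    by_contra h0
    obtain ⟨P, hP, hrnP⟩ := sk_exists_P r
      (IsLocalRing.le_maximalIdeal hP₀.1.ne_top (hrP _ hP₀)) h0
    exact hrnP (hrP P hP)
  rw [hF, bot_sup_eq] at hB
  let S' := S.filter (fun P => Minimal (· ∈ S) P)
  have hmin : ∀ P ∈ S, ∃ Q ∈ S', Q ≤ P := by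
    intro P hP
    obtain ⟨Q, hQP, hQ⟩ := Finset.exists_le_minimal S hP
    exact ⟨Q, Finset.mem_filter.mpr ⟨hQ.1, hQ⟩, hQP⟩
  obtain ⟨I, w, h1, -, h3⟩ := sk_multi k S' (by
      obtain ⟨P, hP⟩ := hSne
      obtain ⟨Q, hQ, -⟩ := hmin P hP
      exact ⟨Q, hQ⟩) (fun P hP => hS P (Finset.mem_filter.mp hP).1) (by
      intro P hP Q hQ hle
      exact le_antisymm hle ((Finset.mem_filter.mp hQ).2.2 (Finset.mem_filter.mp hP).1 hle))
  refine ⟨I, w, h1, le_trans (Finset.le_inf fun P hP => ?_) hB⟩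
  obtain ⟨Q, hQ, hQP⟩ := hmin P hP
  exact (h3 Q hQ).trans (sup_le_sup_right hQP _)
end SkodaAux2

section SkodaAux3
variable {A : Type u} [CommRing A]

theorem sk_avoid [IsLocalRing A] (hinf : Infinite (IsLocalRing.ResidueField A))
    {M : Type*} [AddCommGroup M] [Module A M] (s : Finset (Submodule A M))
    (hs : ∀ N ∈ s, N ≠ ⊤) : ∃ x : M, ∀ N ∈ s, x ∉ N := by
  classical
  induction s using Finset.induction_on with
  | empty => exact ⟨0, by simp⟩
  | insert N s hN ih =>
    obtain ⟨x, hx⟩ := ih fun N' h => hs N' (by simp [h])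
    obtain ⟨y, -, hy⟩ := SetLike.exists_of_lt (lt_top_iff_ne_top.mpr (hs N (by simp)))
    by_contra hc
    push Not at hc
    let lift : IsLocalRing.ResidueField A → A :=
      fun u => (IsLocalRing.residue_surjective u).choose
    have hlift : ∀ u, IsLocalRing.residue A (lift u) = u :=
      fun u => (IsLocalRing.residue_surjective u).choose_spec
    have hc' : ∀ u : IsLocalRing.ResidueField A, ∃ N' : {N' // N' ∈ insert N s},
        x + lift u • y ∈ N'.1 := fun u => by
      obtain ⟨N', h1, h2⟩ := hc (x + lift u • y)
      exact ⟨⟨N', h1⟩, h2⟩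
    choose φ hφ using hc'
    obtain ⟨u, v, huv, he⟩ := Finite.exists_ne_map_eq_of_infinite φ
    have h1 := hφ u
    have h2 := hφ v
    rw [← he] at h2
    set N' := φ u
    have h3 : (lift u - lift v) • y ∈ N'.1 := by
      have := N'.1.sub_mem h1 h2
      rwa [add_sub_add_left_eq_sub, ← sub_smul] at this
    have hu : IsUnit (lift u - lift v) := by
      by_contra hn
      have : lift u - lift v ∈ IsLocalRing.maximalIdeal A := by simpa using hn
      rw [← IsLocalRing.residue_eq_zero_iff, map_sub, hlift, hlift, sub_eq_zero] at this
      exact huv this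
    have h4 : y ∈ N'.1 := by
      obtain ⟨c, hc⟩ := hu.exists_left_inv
      have := N'.1.smul_mem c h3
      rwa [smul_smul, hc, one_smul] at this
    rcases Finset.mem_insert.mp N'.2 with h | h
    · exact hy (h ▸ h4)
    · refine hx _ h ?_
      have := N'.1.sub_mem h1 (N'.1.smul_mem (lift u) h4)
      simpa using this

open Polynomial

/-- the element `r t^n` of the Rees algebra -/
noncomputable def skMon (a : Ideal A) (n : ℕ) : (a ^ n : Ideal A) →ₗ[A] reesAlgebra a where
  toFun r := ⟨monomial n (r : A), reesAlgebra.monomial_mem.mpr r.2⟩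
  map_add' x y := by ext1; simp
  map_smul' c x := by ext1; simp [smul_monomial]

/-- the element `r t` of the Rees algebra -/
noncomputable def skT (a : Ideal A) : a →ₗ[A] reesAlgebra a where
  toFun r := ⟨monomial 1 (r : A), reesAlgebra.monomial_mem.mpr (by simp)⟩
  map_add' x y := by ext1; simp
  map_smul' c x := by ext1; simp [smul_monomial]

/-- the strict transform of a prime -/
noncomputable def skPS (a p : Ideal A) : Ideal (reesAlgebra a) :=
  (p.map (C : A →+* A[X])).comap (reesAlgebra a).val

theorem mem_skPS {a p : Ideal A} {f : reesAlgebra a} :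
    f ∈ skPS a p ↔ ∀ n, (f : A[X]).coeff n ∈ p := by
  unfold skPS
  rw [Ideal.mem_comap, Ideal.mem_map_C_iff]
  rfl

theorem skPS_prime (a p : Ideal A) [p.IsPrime] : (skPS a p).IsPrime := by
  unfold skPS
  have : (p.map (C : A →+* A[X])).IsPrime := Ideal.isPrime_map_C_of_isPrime
  exact Ideal.IsPrime.comap _

theorem sk_rees_sum {a : Ideal A} (f : reesAlgebra a) :
    f = ∑ n ∈ (f : A[X]).support, skMon a n ⟨(f : A[X]).coeff n, f.2 n⟩ := by
  ext1
  rw [AddSubmonoidClass.coe_finsetSum]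
  exact (f : A[X]).as_sum_support

/-- if `p ≤ Q ∩ R`, and some `y t ∉ Q` with `y ∉ Q`, then `Q` contains the strict transform. -/
theorem sk_contains {a p : Ideal A} {Q : Ideal (reesAlgebra a)} [Q.IsPrime] {y : a}
    (hp : p ≤ Q.comap (algebraMap A (reesAlgebra a)))
    (hy : algebraMap A (reesAlgebra a) y ∉ Q) : skPS a p ≤ Q := by
  intro f hf
  rw [sk_rees_sum f]
  refine Ideal.sum_mem _ fun n _ => ?_
  have h1 : algebraMap A (reesAlgebra a) y ^ n * skMon a n ⟨(f : A[X]).coeff n, f.2 n⟩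
      = algebraMap A (reesAlgebra a) ((f : A[X]).coeff n) * (skT a y) ^ n := by
    ext1
    have : (C (y : A) : A[X]) ^ n * monomial n ((f : A[X]).coeff n)
        = C ((f : A[X]).coeff n) * (monomial 1 (y : A)) ^ n := by
      rw [monomial_pow, ← C_pow, C_mul_monomial, C_mul_monomial, mul_comm, one_mul]
    exact this
  have h2 : algebraMap A (reesAlgebra a) y ^ n * skMon a n ⟨(f : A[X]).coeff n, f.2 n⟩ ∈ Q := by
    rw [h1]
    exact Ideal.mul_mem_right _ _ (hp (mem_skPS.mp hf n))
  rcases Ideal.IsPrime.mem_or_mem inferInstance h2 with h | h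
  · exact absurd (Ideal.IsPrime.mem_of_pow_mem inferInstance _ h) hy
  · exact h

theorem sk_swap {a : Ideal A} (x y : a) :
    algebraMap A (reesAlgebra a) x * skT a y = algebraMap A (reesAlgebra a) y * skT a x := by
  ext1
  simp [skT, C_mul_monomial, mul_comm]

theorem sk_generic [IsNoetherianRing A] [IsReduced A] [IsLocalRing A]
    (hinf : Infinite (IsLocalRing.ResidueField A)) (a : Ideal A)
    (hht : ∀ P ∈ minimalPrimes A, ¬ a ≤ P) (k : ℕ) :
    ∃ x : Fin k → a, ∃ T : Set (Ideal A), T.Finite ∧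
      (∀ p ∈ T, p.IsPrime ∧ ¬ a ≤ p ∧ (k : ℕ∞) ≤ p.height) ∧
      ∀ Q : Ideal (reesAlgebra a), Q.IsPrime → (∀ i, skT a (x i) ∈ Q) → (∃ y, skT a y ∉ Q) →
        ∃ p ∈ T, skPS a p ≤ Q := by
  classical
  induction k with
  | zero =>
    refine ⟨Fin.elim0, minimalPrimes A, minimalPrimes.finite_of_isNoetherianRing A,
      fun p hp => ⟨hp.1.1, hht p hp, by simp⟩, fun Q hQ _ _ => ?_⟩
    have hfin := minimalPrimes.finite_of_isNoetherianRing A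
    have hle : hfin.toFinset.inf (skPS a) ≤ Q := by
      intro f hf
      rw [Submodule.mem_finsetInf] at hf
      have : f = 0 := by
        ext n
        have h0 : (f : A[X]).coeff n ∈ sInf (minimalPrimes A) := by
          rw [Submodule.mem_sInf]
          intro p hp
          exact mem_skPS.mp (hf p (by simpa using hp)) n
        have h1 : sInf (minimalPrimes A) = ⊥ := by
          have := Ideal.sInf_minimalPrimes (I := (⊥ : Ideal A))
          rw [minimalPrimes, this]
          exact nilradical_eq_zero A
        rw [h1] at h0
        simpa using h0
      rw [this]; exact Q.zero_mem
    obtain ⟨p, hp, hpQ⟩ := (Ideal.IsPrime.inf_le' hQ).mp hle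
    exact ⟨p, by simpa using hp, hpQ⟩
  | succ k ih =>
    obtain ⟨x, T, hTfin, hT, hQ⟩ := ih
    -- bad primes of the Rees algebra
    let aS : Ideal (reesAlgebra a) := a.map (algebraMap A (reesAlgebra a))
    let Bad : Set (Ideal (reesAlgebra a)) := ⋃ p ∈ T, (skPS a p ⊔ aS).minimalPrimes
    have hBad : Bad.Finite :=
      hTfin.biUnion fun p _ => Ideal.finite_minimalPrimes_of_isNoetherianRing _ _
    let f1 : Ideal (reesAlgebra a) → Submodule A a :=
      fun Q => (Q.restrictScalars A).comap (skT a)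
    let f2 : Ideal A → Submodule A a := fun p => Submodule.comap a.subtype p
    obtain ⟨x', hx'⟩ := sk_avoid hinf
      (((hBad.toFinset.image f1) ∪ (hTfin.toFinset.image f2)).filter (· ≠ ⊤))
      (fun N hN => (Finset.mem_filter.mp hN).2)
    have hx1 : ∀ Q ∈ Bad, (∃ y, skT a y ∉ Q) → skT a x' ∉ Q := by
      rintro Q hQB ⟨y, hy⟩ hmem
      refine hx' (f1 Q) (Finset.mem_filter.mpr ⟨Finset.mem_union_left _
        (Finset.mem_image_of_mem _ (by simpa using hQB)), fun htop => hy ?_⟩) hmem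
      have : y ∈ f1 Q := by rw [htop]; trivial
      exact this
    have hx2 : ∀ p ∈ T, (x' : A) ∉ p := by
      intro p hp hmem
      refine hx' (f2 p) (Finset.mem_filter.mpr ⟨Finset.mem_union_right _
        (Finset.mem_image_of_mem _ (by simpa using hp)), fun htop => (hT p hp).2.1 ?_⟩) hmem
      intro y hy
      have : (⟨y, hy⟩ : a) ∈ f2 p := by rw [htop]; trivial
      exact this
    refine ⟨Fin.cons x' x,
      {p' | ¬ a ≤ p' ∧ p' ∈ ⋃ p ∈ T, (p ⊔ Ideal.span {(x' : A)}).minimalPrimes}, ?_, ?_, ?_⟩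
    · refine Set.Finite.subset (s := ⋃ p ∈ T, (p ⊔ Ideal.span {(x' : A)}).minimalPrimes)
        (hTfin.biUnion fun p _ => Ideal.finite_minimalPrimes_of_isNoetherianRing _ _)
        fun p hp => hp.2
    · rintro p' ⟨hap', hp'⟩
      simp only [Set.mem_iUnion] at hp'
      obtain ⟨p, hp, hp'⟩ := hp'
      have hp'p := hp'.1.1
      have hpp := (hT p hp).1
      refine ⟨hp'p, hap', ?_⟩
      have hlt : p < p' := by
        refine lt_of_le_of_ne (le_sup_left.trans hp'.1.2) fun he => hx2 p hp ?_
        rw [he]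
        exact hp'.1.2 (Ideal.mem_sup_right (Ideal.mem_span_singleton_self _))
      have h1 := Ideal.height_add_one_le_of_lt_of_isPrime hlt
      push_cast
      exact (add_le_add_left (hT p hp).2.2 1).trans h1
    · intro Q hQp hxQ hyQ
      rw [Fin.forall_fin_succ] at hxQ
      simp only [Fin.cons_zero, Fin.cons_succ] at hxQ
      obtain ⟨hx'Q, hxQ⟩ := hxQ
      obtain ⟨p, hpT, hpQ⟩ := hQ Q hQp hxQ hyQ
      obtain ⟨y, hy⟩ := hyQ
      have hpp := (hT p hpT).1
      have hPSp := skPS_prime a p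
      obtain ⟨Q', hQ', hQ'Q⟩ := Ideal.exists_minimalPrimes_le
        (show Ideal.span (insert (skT a x') (skPS a p : Set (reesAlgebra a))) ≤ Q by
          rw [Ideal.span_le, Set.insert_subset_iff]; exact ⟨hx'Q, hpQ⟩)
      have hQ'p := hQ'.1.1
      have hyQ' : skT a y ∉ Q' := fun h => hy (hQ'Q h)
      have hpQ' : skPS a p ≤ Q' := fun z hz =>
        hQ'.1.2 (Ideal.subset_span (Set.mem_insert_of_mem _ hz))
      have hxQ' : skT a x' ∈ Q' := hQ'.1.2 (Ideal.subset_span (Set.mem_insert _ _))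
      have hcontr : ∀ r : A, algebraMap A (reesAlgebra a) r ∈ skPS a p → r ∈ p := by
        intro r hr
        have := mem_skPS.mp hr 0
        simpa using this
      have hcontr' : ∀ r ∈ p, algebraMap A (reesAlgebra a) r ∈ skPS a p := by
        intro r hr
        rw [mem_skPS]
        intro n
        change (C r : A[X]).coeff n ∈ p
        rw [coeff_C]
        split_ifs
        exacts [hr, p.zero_mem]
      by_cases haQ' : aS ≤ Q'
      · exfalso
        obtain ⟨Q'', hQ'', hQ''Q'⟩ := Ideal.exists_minimalPrimes_le (sup_le hpQ' haQ')
        have hQ''p := hQ''.1.1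
        have hxQ'' : skT a x' ∉ Q'' := hx1 Q'' (by
          simp only [Bad, Set.mem_iUnion]; exact ⟨p, hpT, hQ''⟩) ⟨y, fun h => hyQ' (hQ''Q' h)⟩
        have hlt : Q'' < Q' := lt_of_le_of_ne hQ''Q' fun he => hxQ'' (he ▸ hxQ')
        have hpQ'' : skPS a p ≤ Q'' := le_sup_left.trans hQ''.1.2
        have hmin := Ideal.mem_minimalPrimes_span_of_mem_minimalPrimes_span_insert hlt _ _ hQ'
          (skPS a p : Set _) hpQ'' (fun z hz => Ideal.le_radical
            (Ideal.subset_span (Set.mem_insert_of_mem _ hz)))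
        rw [Ideal.span_eq] at hmin
        have hle : Q'' ≤ skPS a p := hmin.2 ⟨hPSp, le_rfl⟩ hpQ''
        refine (hT p hpT).2.1 fun r hr => hcontr r (hle (hQ''.1.2 (Ideal.mem_sup_right ?_)))
        exact Ideal.mem_map_of_mem _ hr
      · obtain ⟨z, hza, hz⟩ : ∃ z ∈ a, algebraMap A (reesAlgebra a) z ∉ Q' := by
          by_contra hc
          push Not at hc
          exact haQ' (Ideal.map_le_iff_le_comap.mpr hc)
        have hyalg : algebraMap A (reesAlgebra a) y ∉ Q' := by
          intro h
          have h1 : algebraMap A (reesAlgebra a) z * skT a y ∈ Q' := by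
            rw [sk_swap ⟨z, hza⟩ y]
            exact Ideal.mul_mem_right _ _ h
          exact (hQ'p.mem_or_mem h1).elim hz hyQ'
        have hx'alg : algebraMap A (reesAlgebra a) x' ∈ Q' := by
          have h1 : algebraMap A (reesAlgebra a) x' * skT a y ∈ Q' := by
            rw [sk_swap]
            exact Ideal.mul_mem_left _ _ hxQ'
          exact (hQ'p.mem_or_mem h1).resolve_right hyQ'
        obtain ⟨p'', hp'', hp''le⟩ := Ideal.exists_minimalPrimes_le
          (show p ⊔ Ideal.span {(x' : A)} ≤ Q'.comap (algebraMap A (reesAlgebra a)) by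
            refine sup_le (fun r hr => hpQ' (hcontr' r hr)) ?_
            rw [Ideal.span_singleton_le_iff_mem]
            exact hx'alg)
        refine ⟨p'', ⟨fun hle => hz (hp''le (hle hza)), ?_⟩,
          (sk_contains hp''le hyalg).trans hQ'Q⟩
        simp only [Set.mem_iUnion]
        exact ⟨p, hpT, hp''⟩

theorem sk_reduction [IsNoetherianRing A] [IsReduced A] [IsLocalRing A]
    (hinf : Infinite (IsLocalRing.ResidueField A)) (a : Ideal A)
    (hht : ∀ P ∈ minimalPrimes A, ¬ a ≤ P) (ha : a ≤ IsLocalRing.maximalIdeal A)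
    (d : ℕ) (hd : ringKrullDim A = d) :
    ∃ x : Fin d → A, (∀ i, x i ∈ a) ∧ ∃ N : ℕ,
      a ^ (N + 1) ≤ Ideal.span (Set.range x) * a ^ N := by
  obtain ⟨x, T, -, hT, hQ⟩ := sk_generic hinf a hht d
  have hTe : ∀ p, p ∉ T := by
    intro p hp
    obtain ⟨hpp, hap, hht⟩ := hT p hp
    have hlt : p < IsLocalRing.maximalIdeal A :=
      lt_of_le_of_ne (IsLocalRing.le_maximalIdeal hpp.ne_top) fun he => hap (he ▸ ha)
    have h1 := Ideal.height_add_one_le_of_lt_of_isPrime hlt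
    have h2 := IsLocalRing.maximalIdeal_height_eq_ringKrullDim (R := A)
    rw [hd] at h2
    have h3 : (IsLocalRing.maximalIdeal A).height = (d : ℕ∞) := by exact_mod_cast h2
    rw [h3] at h1
    have h4 := (add_le_add_left hht 1).trans h1
    exact absurd h4 (by exact_mod_cast (by omega : ¬ d + 1 ≤ d))
  let U : Ideal (reesAlgebra a) := Ideal.span (Set.range fun i => skT a (x i))
  let V : Ideal (reesAlgebra a) := Ideal.span (Set.range fun y => skT a y)
  have hVU : V ≤ U.radical := by
    rw [Ideal.radical_eq_sInf]
    refine le_sInf ?_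
    rintro Q ⟨hUQ, hQp⟩
    rw [Ideal.span_le]
    rintro _ ⟨y, rfl⟩
    by_contra hy
    obtain ⟨p, hp, -⟩ := hQ Q hQp (fun i => hUQ (Ideal.subset_span ⟨i, rfl⟩)) ⟨y, hy⟩
    exact hTe p hp
  obtain ⟨N, hN⟩ := Ideal.exists_pow_le_of_le_radical_of_fg hVU (IsNoetherian.noetherian V)
  refine ⟨fun i => x i, fun i => (x i).2, N, fun r hr => ?_⟩
  have hmon : ∀ n, ∀ r ∈ a ^ n, ∃ f ∈ V ^ n, (f : A[X]) = monomial n r := by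
    intro n
    induction n with
    | zero => intro r _; exact ⟨algebraMap A _ r, by simp, rfl⟩
    | succ n ih =>
      intro r hr
      rw [pow_succ] at hr
      induction hr using Submodule.mul_induction_on' with
      | mem_mul_mem m hm z hz =>
        obtain ⟨f, hf, hf'⟩ := ih m hm
        refine ⟨f * skT a ⟨z, hz⟩, ?_, ?_⟩
        · rw [pow_succ]
          exact Ideal.mul_mem_mul hf (Ideal.subset_span ⟨_, rfl⟩)
        · simp [hf', skT, monomial_mul_monomial]
      | add u _ v _ h1 h2 =>
        obtain ⟨f, hf, hf'⟩ := h1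
        obtain ⟨g, hg, hg'⟩ := h2
        exact ⟨f + g, Ideal.add_mem _ hf hg, by simp [hf', hg']⟩
  obtain ⟨f, hf, hf'⟩ := hmon _ r hr
  have hfU : f ∈ U := hN (Ideal.pow_le_pow_right (Nat.le_succ N) hf)
  obtain ⟨c, hc⟩ := Ideal.mem_span_range_iff_exists_fun.mp hfU
  have hr' : r = ∑ i, (c i : A[X]).coeff N * x i := by
    have h1 : (f : A[X]).coeff (N + 1) = r := by rw [hf']; simp
    rw [← h1, ← hc, AddSubmonoidClass.coe_finsetSum, finsetSum_coeff]
    refine Finset.sum_congr rfl fun i _ => ?_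
    simp [skT, coeff_mul_monomial]
  rw [hr']
  refine Ideal.sum_mem _ fun i _ => ?_
  have h9 := Ideal.mul_mem_mul (Ideal.subset_span ⟨i, rfl⟩ :
    (x i : A) ∈ Ideal.span (Set.range fun i => (x i : A))) ((c i).2 N)
  rwa [mul_comm (x i : A)] at h9

end SkodaAux3

section SkodaAux4
variable {A : Type u} [CommRing A]

theorem sk_one_mem : (1 : A) ∈ Rcirc A := fun P hP h =>
  hP.1.1.ne_top ((Ideal.eq_top_iff_one P).mpr h)

theorem sk_mul_mem {c c' : A} (h : c ∈ Rcirc A) (h' : c' ∈ Rcirc A) : c * c' ∈ Rcirc A :=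
  fun P hP hm => (hP.1.1.mem_or_mem hm).elim (h P hP) (h' P hP)

theorem sk_pow_mem {c : A} (h : c ∈ Rcirc A) (n : ℕ) : c ^ n ∈ Rcirc A :=
  fun P hP hm => h P hP (hP.1.1.mem_of_pow_mem n hm)

theorem sk_prod_mem {ι : Type*} (s : Finset ι) (c : ι → A) (h : ∀ i, c i ∈ Rcirc A) :
    ∏ i ∈ s, c i ∈ Rcirc A := by
  intro P hP hm
  have := hP.1.1
  obtain ⟨i, -, hi⟩ := (Ideal.IsPrime.prod_mem_iff (p := P)).mp hm
  exact h i P hP hi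

theorem sk_exists_circ [IsNoetherianRing A] (a : Ideal A)
    (hht : ∀ P ∈ minimalPrimes A, ¬ a ≤ P) : ∃ g ∈ a, g ∈ Rcirc A := by
  have hfin : (minimalPrimes A).Finite := minimalPrimes.finite_of_isNoetherianRing A
  by_contra hc
  push Not at hc
  have hsub : (a : Set A) ⊆ ⋃ P ∈ (hfin.toFinset : Set (Ideal A)), (P : Set A) := by
    intro g hg
    have := hc g hg
    simp only [Rcirc, Set.mem_ofPred_eq, not_forall, not_not] at this
    obtain ⟨P, hP, hgP⟩ := this
    simp only [Set.mem_iUnion]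
    exact ⟨P, by simpa using hP, hgP⟩
  rw [Ideal.subset_union_prime (f := fun P => P) ⊥ ⊥] at hsub
  · obtain ⟨P, hP, h⟩ := hsub
    exact hht P (by simpa using hP) h
  · intro P hP _ _
    have : P ∈ minimalPrimes A := by simpa using hP
    exact this.1.1

theorem sk_frob_mono {I J : Ideal A} (h : I ≤ J) (q : ℕ) : frobPow A I q ≤ frobPow A J q :=
  Ideal.span_mono (Set.image_mono h)

theorem sk_frob_scale {I J : Ideal A} (y : A) (h : ∀ x ∈ I, y * x ∈ J) (q : ℕ) {v : A}
    (hv : v ∈ frobPow A I q) : y ^ q * v ∈ frobPow A J q := by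
  have : frobPow A I q ≤ Submodule.comap (LinearMap.mulLeft A (y ^ q)) (frobPow A J q) := by
    refine Ideal.span_le.mpr ?_
    rintro _ ⟨x, hx, rfl⟩
    change y ^ q * x ^ q ∈ frobPow A J q
    rw [← mul_pow]
    exact Ideal.subset_span ⟨_, h x hx, rfl⟩
  exact this hv

/-- the tight closure as an ideal -/
def skTC (p : ℕ) [Fact p.Prime] [CharP A p] (a b : Ideal A) (s : ℕ) (t : ℚ) (J : Ideal A) :
    Ideal A where
  carrier := tightClosure2 A p a b s t J
  zero_mem' := by
    refine ⟨1, sk_one_mem, 0, fun e _ x _ => ?_⟩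
    rw [zero_pow (pow_ne_zero _ (Fact.out : p.Prime).ne_zero)]
    simp
  add_mem' := by
    rintro z z' ⟨c, hc, e, he⟩ ⟨c', hc', e', he'⟩
    refine ⟨c * c', sk_mul_mem hc hc', max e e', fun k hk x hx => ?_⟩
    have h1 := he k (le_trans (le_max_left _ _) hk) x hx
    have h2 := he' k (le_trans (le_max_right _ _) hk) x hx
    rw [add_pow_char_pow]
    have : c * c' * (z ^ p ^ k + z' ^ p ^ k) * x
        = c' * (c * z ^ p ^ k * x) + c * (c' * z' ^ p ^ k * x) := by ring
    rw [this]
    exact Ideal.add_mem _ (Ideal.mul_mem_left _ _ h1) (Ideal.mul_mem_left _ _ h2)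
  smul_mem' := by
    rintro r z ⟨c, hc, e, he⟩
    refine ⟨c, hc, e, fun k hk x hx => ?_⟩
    have h1 := he k hk x hx
    have : c * (r • z) ^ p ^ k * x = r ^ p ^ k * (c * z ^ p ^ k * x) := by
      rw [smul_eq_mul]; ring
    rw [this]
    exact Ideal.mul_mem_left _ _ h1

section
variable {p : ℕ} [Fact p.Prime] [CharP A p] {a b : Ideal A} {s : ℕ} {t : ℚ}

theorem mem_skTC {J : Ideal A} {z : A} : z ∈ skTC p a b s t J ↔
    ∃ c ∈ Rcirc A, ∃ e₀ : ℕ, ∀ e : ℕ, e₀ ≤ e →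
    ∀ x ∈ a ^ (s * p ^ e) * b ^ ⌈t * (p : ℚ) ^ e⌉₊,
      c * z ^ p ^ e * x ∈ frobPow A J (p ^ e) := Iff.rfl

theorem sk_mem_test {u : A} : u ∈ testIdeal2 A p a b s t ↔
    ∀ J : Ideal A, ∀ z ∈ skTC p a b s t J, u * z ∈ J := by
  unfold testIdeal2
  rw [Submodule.mem_iInf]
  refine forall_congr' fun J => ?_
  have : Ideal.span (tightClosure2 A p a b s t J) = skTC p a b s t J :=
    Ideal.span_eq (skTC p a b s t J)
  rw [this, Submodule.mem_colon]
  rfl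

theorem sk_le_TC (J : Ideal A) : J ≤ skTC p a b s t J := by
  intro z hz
  refine mem_skTC.mpr ⟨1, sk_one_mem, 0, fun e _ x _ => ?_⟩
  rw [one_mul]
  exact Ideal.mul_mem_right _ _ (Ideal.subset_span ⟨z, hz, rfl⟩)

theorem sk_TC_scale {I J : Ideal A} (y : A) (h : ∀ x ∈ I, y * x ∈ J) {z : A}
    (hz : z ∈ skTC p a b s t I) : y * z ∈ skTC p a b s t J := by
  obtain ⟨c, hc, e, he⟩ := mem_skTC.mp hz
  refine mem_skTC.mpr ⟨c, hc, e, fun k hk x hx => ?_⟩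
  have := sk_frob_scale y h (p ^ k) (he k hk x hx)
  rwa [show y ^ p ^ k * (c * z ^ p ^ k * x) = c * (y * z) ^ p ^ k * x by ring] at this

theorem sk_TC_mono {I J : Ideal A} (h : I ≤ J) : skTC p a b s t I ≤ skTC p a b s t J := by
  intro z hz
  have := sk_TC_scale (J := J) 1 (fun x hx => by rw [one_mul]; exact h hx) hz
  rwa [one_mul] at this

theorem sk_TC_mul {J : Ideal A} {z x : A} (hz : z ∈ skTC p a b (s + 1) t J) (hx : x ∈ a) :
    x * z ∈ skTC p a b s t J := by
  obtain ⟨c, hc, e, he⟩ := mem_skTC.mp hz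
  refine mem_skTC.mpr ⟨c, hc, e, fun k hk w hw => ?_⟩
  have : x ^ p ^ k * w ∈ a ^ ((s + 1) * p ^ k) * b ^ ⌈t * (p : ℚ) ^ k⌉₊ := by
    rw [add_mul, one_mul, add_comm, pow_add, mul_assoc]
    exact Ideal.mul_mem_mul (Ideal.pow_mem_pow hx _) hw
  have := he k hk _ this
  rwa [show c * z ^ p ^ k * (x ^ p ^ k * w) = c * (x * z) ^ p ^ k * w by ring] at this

theorem sk_easy : testIdeal2 A p a b s t * a ≤ testIdeal2 A p a b (s + 1) t := by
  refine Ideal.mul_le.mpr fun u hu x hx => ?_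
  rw [sk_mem_test] at hu ⊢
  intro J z hz
  rw [mul_assoc]
  exact hu J _ (sk_TC_mul hz hx)

theorem sk_pigeon {d : ℕ} (x : Fin d → A) (q m k : ℕ) (hm : m = q + k) (h : d * q ≤ m)
    (hq : 0 < q) :
    Ideal.span (Set.range x) ^ m ≤
      (⨆ i, Ideal.span {x i ^ q}) * Ideal.span (Set.range x) ^ k := by
  classical
  set I := Ideal.span (Set.range x) with hI
  have hle : ∀ i, Ideal.span {x i} ≤ I := fun i =>
    Ideal.span_mono (Set.singleton_subset_iff.mpr ⟨i, rfl⟩)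
  have hsum : I = ∑ i, Ideal.span {x i} := by
    rw [hI, Ideal.sum_eq_sup, Finset.sup_univ_eq_iSup, ← Ideal.span_iUnion]
    congr 1
    ext y; simp [eq_comm]
  have hexp : I ^ m = ∑ κ ∈ Finset.piAntidiag Finset.univ m,
      (Nat.multinomial Finset.univ κ : Ideal A) * ∏ i, Ideal.span {x i} ^ κ i := by
    conv_lhs => rw [hsum]
    exact Finset.sum_pow_eq_sum_piAntidiag _ _ _
  rw [hexp, Ideal.sum_eq_sup]
  refine Finset.sup_le fun κ hκ => le_trans Ideal.mul_le_right ?_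
  have hκ' : ∑ i, κ i = m := (Finset.mem_piAntidiag.mp hκ).1
  have : ∃ i, q ≤ κ i := by
    by_contra hc
    push Not at hc
    rcases Nat.eq_zero_or_pos d with h0 | h0
    · subst h0
      simp at hκ'
      omega
    · have : ∑ i, κ i < ∑ _i : Fin d, q :=
        Finset.sum_lt_sum_of_nonempty ⟨⟨0, h0⟩, Finset.mem_univ _⟩ fun i _ => hc i
      simp at this
      omega
  obtain ⟨i, hi⟩ := this
  rw [← Finset.mul_prod_erase _ _ (Finset.mem_univ i)]
  rw [← Finset.add_sum_erase _ _ (Finset.mem_univ i)] at hκ'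
  have hprod : ∏ j ∈ Finset.univ.erase i, Ideal.span {x j} ^ κ j ≤
      I ^ ∑ j ∈ Finset.univ.erase i, κ j := by
    rw [← Finset.prod_pow_eq_pow_sum]
    exact Finset.prod_le_prod' fun j _ => Ideal.pow_right_mono (hle j) _
  obtain ⟨l, hl⟩ := Nat.exists_eq_add_of_le hi
  rw [hl, pow_add, mul_assoc]
  refine Ideal.mul_mono ?_ ?_
  · rw [Ideal.span_singleton_pow]
    exact le_iSup (fun i => Ideal.span {x i ^ q}) i
  · have : k = l + ∑ j ∈ Finset.univ.erase i, κ j := by omega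
    rw [this, pow_add]
    exact Ideal.mul_mono (Ideal.pow_right_mono (hle i) _) hprod

theorem sk_red_pow {I a : Ideal A} {N : ℕ} (h : a ^ (N + 1) ≤ I * a ^ N) (j : ℕ) :
    a ^ (N + j) ≤ I ^ j * a ^ N := by
  induction j with
  | zero => simp
  | succ j ih =>
    calc a ^ (N + (j + 1)) = a ^ (N + j) * a := by rw [← add_assoc, pow_succ]
      _ ≤ I ^ j * a ^ N * a := Ideal.mul_mono_left ih
      _ = I ^ j * a ^ (N + 1) := by rw [mul_assoc, pow_succ]
      _ ≤ I ^ j * (I * a ^ N) := Ideal.mul_mono_right h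
      _ = I ^ (j + 1) * a ^ N := by rw [pow_succ, mul_assoc]

theorem sk_key {d : ℕ} (x : Fin d → A) (hx : ∀ i, x i ∈ a) {N : ℕ}
    (hN : a ^ (N + 1) ≤ Ideal.span (Set.range x) * a ^ N) (hds : d ≤ s + 1)
    {g : A} (hga : g ∈ a) (hg : g ∈ Rcirc A) {J : Ideal A} {z : A}
    (hz : ∀ y ∈ a, y * z ∈ skTC p a b s t J) : z ∈ skTC p a b (s + 1) t J := by
  classical
  choose c hc e he using fun i => mem_skTC.mp (hz (x i) (hx i))
  refine mem_skTC.mpr ⟨(∏ i, c i) * g ^ N, sk_mul_mem (sk_prod_mem _ _ hc) (sk_pow_mem hg N),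
    Finset.univ.sup e, fun k hk w hw => ?_⟩
  set q := p ^ k with hq
  have hqpos : 0 < q := pow_pos (Fact.out : p.Prime).pos _
  set B := b ^ ⌈t * (p : ℚ) ^ k⌉₊
  have hIa : Ideal.span (Set.range x) ≤ a := by
    refine Ideal.span_le.mpr ?_
    rintro _ ⟨i, rfl⟩
    exact hx i
  have h1 : g ^ N * w ∈ (⨆ i, Ideal.span {x i ^ q}) * (a ^ (s * q) * B) := by
    have h2 : g ^ N * w ∈ a ^ (N + (s + 1) * q) * B := by
      rw [pow_add, mul_assoc]
      exact Ideal.mul_mem_mul (Ideal.pow_mem_pow hga _) hw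
    have h3 : a ^ (N + (s + 1) * q) ≤ (⨆ i, Ideal.span {x i ^ q}) * a ^ (s * q) := by
      refine (sk_red_pow hN _).trans (Ideal.mul_le_left.trans ?_)
      refine (sk_pigeon x q ((s + 1) * q) (s * q) (by ring) (Nat.mul_le_mul_right _ hds)
        hqpos).trans ?_
      exact Ideal.mul_mono_right (Ideal.pow_right_mono hIa _)
    rw [← mul_assoc]
    exact Ideal.mul_mono_left h3 h2
  have h4 : (⨆ i, Ideal.span {x i ^ q}) * (a ^ (s * q) * B) ≤
      Submodule.comap (LinearMap.mulLeft A ((∏ i, c i) * z ^ q)) (frobPow A J q) := by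
    rw [Ideal.iSup_mul]
    refine iSup_le fun i => ?_
    refine Ideal.span_singleton_mul_le_iff.mpr fun v hv => ?_
    change (∏ i, c i) * z ^ q * (x i ^ q * v) ∈ frobPow A J q
    have h5 := he i k (le_trans (Finset.le_sup (Finset.mem_univ i)) hk) v hv
    rw [← Finset.mul_prod_erase _ _ (Finset.mem_univ i)]
    have := Ideal.mul_mem_left _ (∏ j ∈ Finset.univ.erase i, c j) h5
    rwa [show (∏ j ∈ Finset.univ.erase i, c j) * (c i * (x i * z) ^ p ^ k * v)
      = c i * (∏ j ∈ Finset.univ.erase i, c j) * z ^ q * (x i ^ q * v) by rw [← hq]; ring] at this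
  have h6 : (∏ i, c i) * z ^ q * (g ^ N * w) ∈ frobPow A J q := h4 h1
  rwa [show (∏ i, c i) * z ^ q * (g ^ N * w) = (∏ i, c i) * g ^ N * z ^ q * w by ring] at h6

/-- the colon ideal `J : J^*` -/
def skL (p : ℕ) [Fact p.Prime] [CharP A p] (a b : Ideal A) (s : ℕ) (t : ℚ) (J : Ideal A) :
    Ideal A where
  carrier := {u | ∀ z ∈ skTC p a b s t J, u * z ∈ J}
  zero_mem' := fun z _ => by rw [zero_mul]; exact J.zero_mem
  add_mem' := fun {u v} hu hv z hz => by
    rw [add_mul]; exact J.add_mem (hu z hz) (hv z hz)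
  smul_mem' := fun r u hu z hz => by
    rw [smul_eq_mul, mul_assoc]; exact J.mul_mem_left _ (hu z hz)

theorem mem_skL {J : Ideal A} {u : A} :
    u ∈ skL p a b s t J ↔ ∀ z ∈ skTC p a b s t J, u * z ∈ J := Iff.rfl

variable [IsLocalRing A] [IsNoetherianRing A]

theorem sk_test_eq : testIdeal2 A p a b s t =
    sInf {L | ∃ I w, SkIrrAt I w ∧ L = skL p a b s t I} := by
  apply le_antisymm
  · refine le_sInf ?_
    rintro _ ⟨I, w, -, rfl⟩ u hu
    exact sk_mem_test.mp hu I
  · intro u hu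
    rw [sk_mem_test]
    intro J z hz
    by_contra hc
    obtain ⟨I, hJI, hI⟩ := sk_exists_irr J (u * z) hc
    have h1 : u ∈ skL p a b s t I := (Submodule.mem_sInf.mp hu) _ ⟨I, _, hI, rfl⟩
    exact hI.1 (h1 z (sk_TC_mono hJI hz))

theorem sk_L_mono {I I' : Ideal A} {w w' : A} (h : SkIrrAt I w) (h' : SkIrrAt I' w')
    (hle : I' ≤ I) : skL p a b s t I' ≤ skL p a b s t I := by
  obtain ⟨y, hy⟩ := sk_embed h h' hle
  intro u hu z hz
  rw [hy]
  have := hu _ (sk_TC_scale y (fun x hx => (hy x).mp hx) hz)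
  rwa [show u * (y * z) = y * (u * z) by ring] at this

theorem sk_hard [IsReduced A] [IsAdicComplete (IsLocalRing.maximalIdeal A) A]
    (hcol : ∀ (J : Ideal A) (z : A), (∀ y ∈ a, y * z ∈ skTC p a b s t J) →
      z ∈ skTC p a b (s + 1) t J) :
    testIdeal2 A p a b (s + 1) t ≤ testIdeal2 A p a b s t * a := by
  have hloc : ∀ I w, SkIrrAt I w →
      testIdeal2 A p a b (s + 1) t ≤ skL p a b s t I * a ⊔ I := by
    intro I w hI u hu
    refine sk_double hI _ le_sup_right u fun y hy => ?_
    have hy' : y ∈ skTC p a b (s + 1) t I := by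
      refine hcol I y fun α hα => ?_
      refine sk_double hI _ (sk_le_TC I) _ fun v hv => ?_
      have hvL : v ∈ skL p a b s t I := hv
      have := hy (v * α) (Ideal.mem_sup_left (Ideal.mul_mem_mul hvL hα))
      rwa [show y * (v * α) = v * (α * y) by ring] at this
    rw [mul_comm]
    exact sk_mem_test.mp hu I y hy'
  set F : Set (Ideal A) := {L | ∃ I w, SkIrrAt I w ∧ L = skL p a b s t I} with hF
  have hcof : ∀ I w, SkIrrAt I w → ∀ I' w', SkIrrAt I' w' → ∀ N,
      ∃ I'' w'', SkIrrAt I'' w'' ∧ I'' ≤ I ∧ I'' ≤ I' ∧ I'' ≤ IsLocalRing.maximalIdeal A ^ N := by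
    intro I w h I' w' h' N
    obtain ⟨N₁, h1⟩ := sk_primary h
    obtain ⟨N₂, h2⟩ := sk_primary h'
    obtain ⟨I'', w'', h'', hle⟩ := sk_approx (A := A) (N₁ + N₂ + N)
    exact ⟨I'', w'', h'', (hle.trans (Ideal.pow_le_pow_right (by omega))).trans h1,
      (hle.trans (Ideal.pow_le_pow_right (by omega))).trans h2,
      hle.trans (Ideal.pow_le_pow_right (by omega))⟩
  have hne : F.Nonempty := by
    obtain ⟨I, w, h, -⟩ := sk_approx (A := A) 0
    exact ⟨_, I, w, h, rfl⟩
  have hdir : ∀ B ∈ F, ∀ C ∈ F, ∃ D ∈ F, D ≤ B ∧ D ≤ C := by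
    rintro _ ⟨I, w, h, rfl⟩ _ ⟨I', w', h', rfl⟩
    obtain ⟨I'', w'', h'', h1, h2, -⟩ := hcof I w h I' w' h' 0
    exact ⟨_, ⟨I'', w'', h'', rfl⟩, sk_L_mono h h'' h1, sk_L_mono h' h'' h2⟩
  intro u hu
  refine sk_closed _ _ fun N => ?_
  obtain ⟨_, ⟨I, w, h, rfl⟩, hle⟩ := sk_chevalley F hne hdir N
  obtain ⟨I', w', h', h1, -, h2⟩ := hcof I w h I w h N
  have h3 := (sk_L_mono h h' h1).trans hle
  rw [← sk_test_eq] at h3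
  have h4 : skL p a b s t I' * a ⊔ I' ≤
      testIdeal2 A p a b s t * a ⊔ IsLocalRing.maximalIdeal A ^ N := by
    refine sup_le ((Ideal.mul_mono_left h3).trans ?_) (h2.trans le_sup_right)
    rw [Ideal.sup_mul]
    exact sup_le_sup_left Ideal.mul_le_left _
  exact h4 (hloc I' w' h' hu)

end

theorem sk_main (p : ℕ) [Fact p.Prime] [CharP A p]
    [IsNoetherianRing A] [IsReduced A] [IsLocalRing A]
    [IsAdicComplete (IsLocalRing.maximalIdeal A) A]
    (d : ℕ) (hd : ringKrullDim A = d)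
    (hinf : Infinite (IsLocalRing.ResidueField A))
    (a : Ideal A) (hht : ∀ P ∈ minimalPrimes A, ¬ a ≤ P) (b : Ideal A) (t : ℚ) (n : ℕ) :
    testIdeal2 A p a b (n + d - 1) t = testIdeal2 A p a b (d - 1) t * a ^ n := by
  by_cases hat : a = ⊤
  · subst hat
    simp only [testIdeal2, tightClosure2, ← Ideal.one_eq_top, one_pow, mul_one]
  have ham : a ≤ IsLocalRing.maximalIdeal A := IsLocalRing.le_maximalIdeal hat
  have hd0 : d ≠ 0 := by
    rintro rfl
    obtain ⟨P, hP, hPm⟩ := Ideal.exists_minimalPrimes_le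
      (bot_le : (⊥ : Ideal A) ≤ IsLocalRing.maximalIdeal A)
    have := hP.1.1
    have : Ring.KrullDimLE 0 A := by
      rw [Ring.krullDimLE_iff]
      rw [hd]
    have hmax : P.IsMaximal := Ideal.isMaximal_of_isPrime P
    rw [IsLocalRing.eq_maximalIdeal hmax] at hP
    exact hht _ hP ham
  obtain ⟨x, hx, N, hN⟩ := sk_reduction hinf a hht ham d hd
  obtain ⟨g, hga, hg⟩ := sk_exists_circ a hht
  induction n with
  | zero => simp
  | succ n ih =>
    rw [pow_succ, ← mul_assoc, ← ih, show n + 1 + d - 1 = (n + d - 1) + 1 by omega]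
    exact le_antisymm
      (sk_hard fun J z hz => sk_key x hx hN (by omega) hga hg hz) sk_easy

end SkodaAux4

/-- **Corollary 4.4** (Hara–Takagi).  `(R,m)` a complete Noetherian reduced local ring of
characteristic `p > 0`, of dimension `d` with infinite residue field, `a` an ideal of positive
height, `b ∩ R° ≠ ∅`, `t ≥ 0` rational.  Then `τ(a^{n+d-1}·bᵗ) = τ(a^{d-1}·bᵗ)·aⁿ` for all
`n ≥ 0`. -/
theorem skoda_dimension_bound
    (p : ℕ) [Fact p.Prime] [CharP R p]
    [IsNoetherianRing R] [IsReduced R] [IsLocalRing R]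
    [IsAdicComplete (IsLocalRing.maximalIdeal R) R]
    (d : ℕ) (hd : ringKrullDim R = d)
    (hinf : Infinite (IsLocalRing.ResidueField R))
    (a : Ideal R) (hht : ∀ P ∈ minimalPrimes R, ¬ a ≤ P)
    (b : Ideal R) (hb : ((b : Set R) ∩ Rcirc R).Nonempty)
    (t : ℚ) (ht : 0 ≤ t) :
    ∀ n : ℕ, testIdeal2 R p a b (n + d - 1) t = testIdeal2 R p a b (d - 1) t * a ^ n := by
  exact fun n => sk_main p d hd hinf a hht b t n
end
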